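/- arXiv:1503.06607 — 9 statements merged into one kernel-verified Lean document; each statement's English description precedes it below -/
import Mathlib

section
/- Let a, b, c ∈ ℝ and let sign(c) = 1 if c > 0, sign(c) = −1 if c < 0, and sign(0) = 0. If c·(a−b) ≥ 0, then ‖(a,b,c)‖ = max{ |a|, (1/2)·|a+b+c|, (1/2)·|a + b + sign(c)·√((a−b)² + c²)| }. If c·(a−b) ≤ 0, then ‖(a,b,c)‖ = max{ |a|, (1/2)·|a+b+c| }. -/
open Real Set

noncomputable section

/-- The sector D(π/4): points (x,y) with 0 ≤ y ≤ x and x² + y² ≤ 1. -/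
def sector : Set (ℝ × ℝ) := {p | 0 ≤ p.2 ∧ p.2 ≤ p.1 ∧ p.1 ^ 2 + p.2 ^ 2 ≤ 1}

/-- The supremum norm of the 2-homogeneous polynomial a·x² + b·y² + c·x·y over the sector. -/
def secNorm (a b c : ℝ) : ℝ :=
  sSup ((fun p : ℝ × ℝ => |a * p.1 ^ 2 + b * p.2 ^ 2 + c * p.1 * p.2|) '' sector)

/-- The polynomial in the double-angle coordinates `u = cos 2θ`, `v = sin 2θ`: values at boundary
points of the sector. -/
theorem half_abs_mem_image_sector (a b c : ℝ) {u v : ℝ} (hu : 0 ≤ u) (hv : 0 ≤ v)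
    (huv : u ^ 2 + v ^ 2 = 1) :
    (1 / 2) * |a + b + ((a - b) * u + c * v)| ∈
      (fun p : ℝ × ℝ => |a * p.1 ^ 2 + b * p.2 ^ 2 + c * p.1 * p.2|) '' sector := by
  have hu1 : u ≤ 1 := by nlinarith
  have hx : √((1 + u) / 2) ^ 2 = (1 + u) / 2 := Real.sq_sqrt (by linarith)
  have hy : √((1 - u) / 2) ^ 2 = (1 - u) / 2 := Real.sq_sqrt (by linarith)
  have hxy : √((1 + u) / 2) * √((1 - u) / 2) = v / 2 := by
    rw [← Real.sqrt_mul (by linarith), show (1 + u) / 2 * ((1 - u) / 2) = (v / 2) ^ 2 by linarith,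
      Real.sqrt_sq (by linarith)]
  refine ⟨(√((1 + u) / 2), √((1 - u) / 2)),
    ⟨Real.sqrt_nonneg _, Real.sqrt_le_sqrt (by linarith), ?_⟩, ?_⟩
  · simp only [hx, hy]
    linarith
  · have h : (1 / 2 : ℝ) = |1 / 2| := by norm_num
    rw [h, ← abs_mul]
    simp only [hx, hy, mul_assoc, hxy]
    congr 1
    ring

/-- An upper bound for the polynomial on the sector, checked in double-angle coordinates. -/
theorem mem_upperBounds_image_sector {a b c M : ℝ}
    (h : ∀ u v s : ℝ, 0 ≤ u → 0 ≤ v → 0 ≤ s → s ≤ 1 → u ^ 2 + v ^ 2 = s ^ 2 →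
      |(a + b) * s + ((a - b) * u + c * v)| ≤ 2 * M) :
    M ∈ upperBounds
      ((fun p : ℝ × ℝ => |a * p.1 ^ 2 + b * p.2 ^ 2 + c * p.1 * p.2|) '' sector) := by
  rintro _ ⟨⟨x, y⟩, ⟨hy, hyx, hxy⟩, rfl⟩
  dsimp only at hy hyx hxy ⊢
  have key := h (x ^ 2 - y ^ 2) (2 * x * y) (x ^ 2 + y ^ 2) (by nlinarith)
    (by have := hy.trans hyx; positivity) (by positivity) hxy (by ring)
  rw [show (a + b) * (x ^ 2 + y ^ 2) + ((a - b) * (x ^ 2 - y ^ 2) + c * (2 * x * y)) =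
    2 * (a * x ^ 2 + b * y ^ 2 + c * x * y) by ring, abs_mul, abs_two] at key
  linarith

/-- A quantity between `s * A` and `s * B`, with `s ∈ [0, 1]`, is bounded by any common bound of
`|A|` and `|B|`. -/
theorem abs_le_of_mul_le_of_le_mul {s A B t N : ℝ} (hs : 0 ≤ s) (hs1 : s ≤ 1)
    (hA : |A| ≤ N) (hB : |B| ≤ N) (h₁ : s * A ≤ t) (h₂ : t ≤ s * B) : |t| ≤ N := by
  have hN : 0 ≤ N := (abs_nonneg A).trans hA
  rw [abs_le] at *
  constructor <;> nlinarith

/-- The linear form `d * u + c * v` on a quarter circle, for coefficients of opposite signs. -/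
theorem linear_form_bounds_of_opposite_signs {d c u v s : ℝ} (hd : d ≤ 0) (hc : 0 ≤ c)
    (hu : 0 ≤ u) (hv : 0 ≤ v) (hs : 0 ≤ s) (h : u ^ 2 + v ^ 2 = s ^ 2) :
    s * d ≤ d * u + c * v ∧ d * u + c * v ≤ s * c := by
  have hus : u ≤ s := abs_le_of_sq_le_sq' (by nlinarith) hs |>.2
  have hvs : v ≤ s := abs_le_of_sq_le_sq' (by nlinarith) hs |>.2
  constructor <;> nlinarith [mul_nonneg hc hv, mul_nonneg (neg_nonneg.2 hd) hu]

/-- The linear form `d * u + c * v` on a quarter circle, for nonnegative coefficients. -/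
theorem linear_form_bounds_of_nonneg {d c u v s : ℝ} (hd : 0 ≤ d) (hc : 0 ≤ c)
    (hu : 0 ≤ u) (hv : 0 ≤ v) (hs : 0 ≤ s) (h : u ^ 2 + v ^ 2 = s ^ 2) :
    s * min d c ≤ d * u + c * v ∧ d * u + c * v ≤ s * √(d ^ 2 + c ^ 2) := by
  have hsuv : s ≤ u + v :=
    abs_le_of_sq_le_sq' (by nlinarith [mul_nonneg hu hv]) (by positivity) |>.2
  constructor
  · have h0 : 0 ≤ min d c := le_min hd hc
    nlinarith [mul_le_mul_of_nonneg_right (min_le_left d c) hu,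
      mul_le_mul_of_nonneg_right (min_le_right d c) hv, mul_le_mul_of_nonneg_right hsuv h0]
  · refine (abs_le_of_sq_le_sq' ?_ (by positivity)).2
    rw [mul_pow, Real.sq_sqrt (by positivity), ← h]
    nlinarith [sq_nonneg (d * v - c * u)]

theorem stmt_0 (a b c : ℝ) :
    (c * (a - b) ≥ 0 →
      secNorm a b c =
        max |a| (max ((1 / 2) * |a + b + c|)
          ((1 / 2) * |a + b + Real.sign c * Real.sqrt ((a - b) ^ 2 + c ^ 2)|))) ∧
    (c * (a - b) ≤ 0 →
      secNorm a b c = max |a| ((1 / 2) * |a + b + c|)) := by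
  have hmem_a := half_abs_mem_image_sector a b c zero_le_one le_rfl (by norm_num)
  have hmem_abc := half_abs_mem_image_sector a b c le_rfl zero_le_one (by norm_num)
  rw [show a + b + ((a - b) * 1 + c * 0) = 2 * a by ring, abs_mul, abs_two,
    show 1 / 2 * (2 * |a|) = |a| by ring] at hmem_a
  rw [show a + b + ((a - b) * 0 + c * 1) = a + b + c by ring] at hmem_abc
  have ha2 : |a + b + (a - b)| = 2 * |a| := by
    rw [show a + b + (a - b) = 2 * a by ring, abs_mul, abs_two]
  constructor
  · intro h
    set R := √((a - b) ^ 2 + c ^ 2) with hR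
    set M := max |a| (max (1 / 2 * |a + b + c|) (1 / 2 * |a + b + Real.sign c * R|)) with hM
    have h₁ : |a| ≤ M := le_max_left _ _
    have h₂ : 1 / 2 * |a + b + c| ≤ M := (le_max_left _ _).trans (le_max_right _ _)
    have h₃ : 1 / 2 * |a + b + Real.sign c * R| ≤ M := (le_max_right _ _).trans (le_max_right _ _)
    refine IsGreatest.csSup_eq ⟨?_, mem_upperBounds_image_sector ?_⟩
    · have hmem_sqrt : 1 / 2 * |a + b + Real.sign c * R| ∈
          (fun p : ℝ × ℝ => |a * p.1 ^ 2 + b * p.2 ^ 2 + c * p.1 * p.2|) '' sector := by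
        rcases eq_or_ne c 0 with rfl | hc
        · simpa using hmem_abc
        have hpos : 0 < (a - b) ^ 2 + c ^ 2 := by positivity
        have hRpos : 0 < R := Real.sqrt_pos.2 hpos
        have hRsq : R ^ 2 = (a - b) ^ 2 + c ^ 2 := Real.sq_sqrt hpos.le
        have hvals := half_abs_mem_image_sector a b c
          (u := |a - b| / R) (v := |c| / R) (by positivity) (by positivity) (by
            rw [div_pow, div_pow, sq_abs, sq_abs, ← add_div, hRsq, div_self hpos.ne'])
        convert hvals using 4
        rcases lt_or_gt_of_ne hc with hc | hc
        · have hd : a - b ≤ 0 := by nlinarith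
          rw [Real.sign_of_neg hc, abs_of_nonpos hd, abs_of_neg hc]
          field_simp
          linarith
        · have hd : 0 ≤ a - b := by nlinarith
          rw [Real.sign_of_pos hc, abs_of_nonneg hd, abs_of_pos hc]
          field_simp
          linarith
      rcases max_choice |a| (max (1 / 2 * |a + b + c|) (1 / 2 * |a + b + Real.sign c * R|))
        with h | h
      · rwa [hM, h]
      · rw [hM, h]
        rcases max_choice (1 / 2 * |a + b + c|) (1 / 2 * |a + b + Real.sign c * R|) with h | h
          <;> rwa [h]
    · intro u v s hu hv hs hs1 huv
      rcases lt_trichotomy c 0 with hc | rfl | hc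
      · have hd : a - b ≤ 0 := by nlinarith
        obtain ⟨hl, hr⟩ := linear_form_bounds_of_nonneg (neg_nonneg.2 hd) (neg_nonneg.2 hc.le)
          hu hv hs huv
        rw [neg_sq, neg_sq, ← hR] at hr
        rw [Real.sign_of_neg hc] at h₃
        refine abs_le_of_mul_le_of_le_mul (A := a + b + -1 * R) (B := a + b + -min (-(a - b)) (-c))
          hs hs1 (by linarith) ?_ (by linarith) (by linarith)
        rcases min_choice (-(a - b)) (-c) with h | h <;> rw [h, neg_neg] <;> linarith
      · rcases le_total 0 (a - b) with hd | hd
        · refine abs_le_of_mul_le_of_le_mul (A := a + b + 0) (B := a + b + (a - b))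
            hs hs1 (by linarith) (by linarith) (by nlinarith) ?_
          have := (linear_form_bounds_of_opposite_signs (neg_nonpos.2 hd) le_rfl hu hv hs huv).1
          linarith
        · refine abs_le_of_mul_le_of_le_mul (A := a + b + (a - b)) (B := a + b + 0)
            hs hs1 (by linarith) (by linarith) ?_ (by nlinarith)
          have := (linear_form_bounds_of_opposite_signs hd le_rfl hu hv hs huv).1
          linarith
      · have hd : 0 ≤ a - b := by nlinarith
        obtain ⟨hl, hr⟩ := linear_form_bounds_of_nonneg hd hc.le hu hv hs huv
        rw [← hR] at hr
        rw [Real.sign_of_pos hc] at h₃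
        refine abs_le_of_mul_le_of_le_mul (A := a + b + min (a - b) c) (B := a + b + 1 * R)
          hs hs1 ?_ (by linarith) (by linarith) (by linarith)
        rcases min_choice (a - b) c with h | h <;> rw [h] <;> linarith
  · intro h
    have h₁ := le_max_left |a| (1 / 2 * |a + b + c|)
    have h₂ := le_max_right |a| (1 / 2 * |a + b + c|)
    refine IsGreatest.csSup_eq ⟨?_, mem_upperBounds_image_sector ?_⟩
    · rcases max_choice |a| (1 / 2 * |a + b + c|) with h | h <;> rwa [h]
    · intro u v s hu hv hs hs1 huv
      rcases mul_nonpos_iff.1 h with ⟨hc, hd⟩ | ⟨hc, hd⟩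
      · obtain ⟨hl, hr⟩ := linear_form_bounds_of_opposite_signs hd hc hu hv hs huv
        exact abs_le_of_mul_le_of_le_mul (A := a + b + (a - b)) (B := a + b + c)
          hs hs1 (by linarith) (by linarith) (by linarith) (by linarith)
      · obtain ⟨hl, hr⟩ := linear_form_bounds_of_opposite_signs (neg_nonpos.2 hd)
          (neg_nonneg.2 hc) hu hv hs huv
        exact abs_le_of_mul_le_of_le_mul (A := a + b + c) (B := a + b + (a - b))
          hs hs1 (by linarith) (by linarith) (by linarith) (by linarith)
end
end

section
/- The set of extreme points of the closed unit ball of ℝ³ equipped with the norm ‖·‖ is exactly { P_t : t ∈ [−1,1] } ∪ { −P_t : t ∈ [−1,1] } ∪ { Q_s : s ∈ [1, 5+4√2] } ∪ { −Q_s : s ∈ [1, 5+4√2] } ∪ { (1,1,0), (−1,−1,0) }. -/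
open Real Set

noncomputable section

/-- The extreme triple P_t. -/
def Pt (t : ℝ) : ℝ × ℝ × ℝ :=
  (t, 4 + t + 4 * Real.sqrt (1 + t), -2 - 2 * t - 4 * Real.sqrt (1 + t))

/-- The extreme triple Q_s. -/
def Qs (s : ℝ) : ℝ × ℝ × ℝ :=
  (1, s, -2 * Real.sqrt (2 * (1 + s)))
/-- The dehomogenised polynomial `a + b·m² + c·m` on the line `x = 1`. -/
def slopePoly (v : ℝ × ℝ × ℝ) (m : ℝ) : ℝ := v.1 + v.2.1 * m ^ 2 + v.2.2 * m

/-- The closed unit ball, described by the slopes `m = y / x ∈ [0, 1]`. -/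
def slopeBall : Set (ℝ × ℝ × ℝ) := {v | ∀ m ∈ Icc (0 : ℝ) 1, |slopePoly v m| ≤ 1 + m ^ 2}

lemma slopePoly_add (v d : ℝ × ℝ × ℝ) (m : ℝ) :
    slopePoly (v + d) m = slopePoly v m + slopePoly d m := by
  simp only [slopePoly, Prod.fst_add, Prod.snd_add]; ring

lemma slopePoly_smul (k : ℝ) (v : ℝ × ℝ × ℝ) (m : ℝ) :
    slopePoly (k • v) m = k * slopePoly v m := by
  simp only [slopePoly, Prod.smul_fst, Prod.smul_snd, smul_eq_mul]; ring

lemma slopePoly_neg (v : ℝ × ℝ × ℝ) (m : ℝ) : slopePoly (-v) m = -slopePoly v m := by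
  simp only [slopePoly, Prod.fst_neg, Prod.snd_neg]; ring

lemma continuous_slopePoly (v : ℝ × ℝ × ℝ) : Continuous (slopePoly v) := by
  unfold slopePoly; fun_prop

lemma bddAbove_sector_image (a b c : ℝ) :
    BddAbove ((fun p : ℝ × ℝ => |a * p.1 ^ 2 + b * p.2 ^ 2 + c * p.1 * p.2|) '' sector) := by
  refine ⟨|a| + |b| + |c|, ?_⟩
  rintro _ ⟨⟨x, y⟩, ⟨hy, hyx, hxy⟩, rfl⟩
  simp only at hy hyx hxy ⊢
  have hx : |x ^ 2| ≤ 1 := by rw [abs_le]; constructor <;> nlinarith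
  have hy' : |y ^ 2| ≤ 1 := by rw [abs_le]; constructor <;> nlinarith
  have hxy' : |x * y| ≤ 1 := by rw [abs_le]; constructor <;> nlinarith
  calc |a * x ^ 2 + b * y ^ 2 + c * x * y|
      ≤ |a * x ^ 2| + |b * y ^ 2| + |c * (x * y)| := by
        rw [mul_assoc c]; exact abs_add_three _ _ _
    _ ≤ |a| + |b| + |c| := by
        simp only [abs_mul a, abs_mul b, abs_mul c]
        gcongr <;> exact mul_le_of_le_one_right (abs_nonneg _) ‹_›

lemma secNorm_le_one_iff (v : ℝ × ℝ × ℝ) :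
    secNorm v.1 v.2.1 v.2.2 ≤ 1 ↔ v ∈ slopeBall := by
  obtain ⟨a, b, c⟩ := v
  constructor
  · rintro h m ⟨h0, h1⟩
    have hpos : 0 < 1 + m ^ 2 := by positivity
    have hs : 0 < √(1 + m ^ 2) := Real.sqrt_pos.2 hpos
    have hsq := Real.sq_sqrt hpos.le
    set r := √(1 + m ^ 2)
    have hmem : ((1 / r, m / r) : ℝ × ℝ) ∈ sector := by
      refine ⟨by positivity, by dsimp only; gcongr, ?_⟩
      simp only [div_pow, hsq]
      field_simp
      simp
    have := (le_csSup (bddAbove_sector_image a b c) (mem_image_of_mem _ hmem)).trans h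
    have heq : a * (1 / r) ^ 2 + b * (m / r) ^ 2 + c * (1 / r) * (m / r)
        = slopePoly (a, b, c) m / (1 + m ^ 2) := by
      rw [← hsq]; simp only [slopePoly]; field_simp
    simp only [heq, abs_div, abs_of_pos hpos] at this
    rwa [div_le_one hpos] at this
  · intro h
    refine csSup_le (Set.Nonempty.image _ ⟨(0, 0), by simp [sector]⟩) ?_
    rintro _ ⟨⟨x, y⟩, ⟨hy, hyx, hxy⟩, rfl⟩
    simp only at hy hyx hxy ⊢
    rcases (hy.trans hyx).eq_or_lt with hx | hx
    · subst hx
      obtain rfl : y = 0 := le_antisymm hyx hy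
      simp
    · have hm := h (y / x) ⟨by positivity, (div_le_one hx).2 hyx⟩
      have heq : a * x ^ 2 + b * y ^ 2 + c * x * y = x ^ 2 * slopePoly (a, b, c) (y / x) := by
        simp only [slopePoly]; field_simp
      have hsum : x ^ 2 * (1 + (y / x) ^ 2) = x ^ 2 + y ^ 2 := by field_simp
      rw [heq, abs_mul, abs_of_pos (by positivity : 0 < x ^ 2)]
      nlinarith [mul_le_mul_of_nonneg_left hm (sq_nonneg x)]

lemma convex_slopeBall : Convex ℝ slopeBall := by
  intro v hv w hw s t hs ht hst m hm
  have hv := abs_le.1 (hv m hm)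
  have hw := abs_le.1 (hw m hm)
  rw [slopePoly_add, slopePoly_smul, slopePoly_smul, abs_le]
  constructor <;> nlinarith

lemma neg_mem_slopeBall {v : ℝ × ℝ × ℝ} (hv : v ∈ slopeBall) : -v ∈ slopeBall := by
  intro m hm
  rw [slopePoly_neg, abs_neg]
  exact hv m hm

/-- In a convex set, a point is extreme iff it is not the midpoint of a nontrivial segment. -/
lemma mem_extremePoints_iff_add_sub {E : Type*} [AddCommGroup E] [Module ℝ E] {A : Set E}
    (hA : Convex ℝ A) {x : E} :
    x ∈ A.extremePoints ℝ ↔ x ∈ A ∧ ∀ d, x + d ∈ A → x - d ∈ A → d = 0 := by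
  constructor
  · rintro ⟨hx, h⟩
    refine ⟨hx, fun d h1 h2 => ?_⟩
    have := h h1 h2 ⟨1 / 2, 1 / 2, by norm_num, by norm_num, by norm_num, by module⟩
    simpa using this
  · rintro ⟨hx, h⟩
    refine ⟨hx, ?_⟩
    rintro y hy z hz ⟨s, t, hs, ht, hst, rfl⟩
    obtain ⟨e, he, hes, het⟩ : ∃ e : ℝ, 0 < e ∧ e ≤ s ∧ e ≤ t :=
      ⟨min s t, lt_min hs ht, min_le_left _ _, min_le_right _ _⟩
    have hd := h (e • (y - z))
      (by
        have := hA hy hz (a := s + e) (b := t - e) (by linarith) (by linarith) (by linarith)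
        convert this using 1; module)
      (by
        have := hA hy hz (a := s - e) (b := t + e) (by linarith) (by linarith) (by linarith)
        convert this using 1; module)
    have hyz : y = z := by
      simpa [he.ne', sub_eq_zero] using hd
    rw [hyz, ← add_smul, hst, one_smul]

/-- Extremality in the ball in terms of the gaps `1 + m² ± f(m)`. -/
lemma mem_extremePoints_slopeBall_iff {v : ℝ × ℝ × ℝ} :
    v ∈ slopeBall.extremePoints ℝ ↔ v ∈ slopeBall ∧ ∀ d : ℝ × ℝ × ℝ,
      (∀ m ∈ Icc (0 : ℝ) 1, |slopePoly d m| ≤ 1 + m ^ 2 + slopePoly v m) →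
      (∀ m ∈ Icc (0 : ℝ) 1, |slopePoly d m| ≤ 1 + m ^ 2 - slopePoly v m) → d = 0 := by
  rw [mem_extremePoints_iff_add_sub convex_slopeBall]
  refine and_congr_right fun _ => forall_congr' fun d => ?_
  constructor
  · intro h h1 h2
    refine h ?_ ?_ <;> intro m hm <;>
      have h1 := abs_le.1 (h1 m hm) <;> have h2 := abs_le.1 (h2 m hm)
    · rw [slopePoly_add, abs_le]; constructor <;> linarith
    · rw [sub_eq_add_neg, slopePoly_add, slopePoly_neg, abs_le]; constructor <;> linarith
  · intro h h1 h2
    refine h ?_ ?_ <;> intro m hm <;>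
      have h1 := abs_le.1 (h1 m hm) <;> have h2 := abs_le.1 (h2 m hm) <;>
      rw [slopePoly_add] at h1 <;> rw [sub_eq_add_neg, slopePoly_add, slopePoly_neg] at h2 <;>
      rw [abs_le] <;> constructor <;> linarith

lemma eq_zero_of_abs_le_gap {v : ℝ × ℝ × ℝ} (hv : v ∈ slopeBall.extremePoints ℝ)
    (d : ℝ × ℝ × ℝ) (C D : ℝ)
    (h1 : ∀ m ∈ Icc (0 : ℝ) 1, |slopePoly d m| ≤ C * (1 + m ^ 2 + slopePoly v m))
    (h2 : ∀ m ∈ Icc (0 : ℝ) 1, |slopePoly d m| ≤ D * (1 + m ^ 2 - slopePoly v m)) : d = 0 := by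
  obtain ⟨hvB, hext⟩ := mem_extremePoints_slopeBall_iff.1 hv
  set M := max 1 (max C D)
  have hM : 0 < M := lt_max_of_lt_left one_pos
  have hCM : C ≤ M := (le_max_left _ _).trans (le_max_right _ _)
  have hDM : D ≤ M := (le_max_right _ _).trans (le_max_right _ _)
  have := hext (M⁻¹ • d)
    (fun m hm => by
      have h0 := abs_le.1 (hvB m hm)
      rw [slopePoly_smul, abs_mul, abs_of_pos (inv_pos.2 hM), inv_mul_le_iff₀ hM]
      exact (h1 m hm).trans (mul_le_mul_of_nonneg_right hCM (by linarith)))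
    (fun m hm => by
      have h0 := abs_le.1 (hvB m hm)
      rw [slopePoly_smul, abs_mul, abs_of_pos (inv_pos.2 hM), inv_mul_le_iff₀ hM]
      exact (h2 m hm).trans (mul_le_mul_of_nonneg_right hDM (by linarith)))
  simpa [hM.ne'] using this

lemma exists_abs_le_mul_of_pos {f g : ℝ → ℝ} (hf : Continuous f) (hg : Continuous g)
    (hpos : ∀ m ∈ Icc (0 : ℝ) 1, 0 < g m) : ∃ C, ∀ m ∈ Icc (0 : ℝ) 1, |f m| ≤ C * g m := by
  obtain ⟨C, hC⟩ := isCompact_Icc.exists_bound_of_continuousOn (s := Icc (0 : ℝ) 1)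
    (f := fun m => f m / g m)
    (hf.continuousOn.div hg.continuousOn fun m hm => (hpos m hm).ne')
  refine ⟨C, fun m hm => ?_⟩
  have := hC m hm
  rwa [Real.norm_eq_abs, abs_div, abs_of_pos (hpos m hm), div_le_iff₀ (hpos m hm)] at this

lemma nonpos_of_forall_mul_le_sq {k M δ : ℝ} (hδ : 0 < δ)
    (h : ∀ s, 0 < s → s ≤ δ → k * s ≤ M * s ^ 2) : k ≤ 0 := by
  by_contra! hk
  have hM : 0 < |M| + 1 := by positivity
  have hs : 0 < min δ (k / (2 * (|M| + 1))) := lt_min hδ (by positivity)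
  have h1 := h _ hs (min_le_left _ _)
  have h2 := min_le_right δ (k / (2 * (|M| + 1)))
  set s := min δ (k / (2 * (|M| + 1)))
  rw [le_div_iff₀ (by positivity)] at h2
  have h3 : k ≤ M * s := by nlinarith
  nlinarith [le_abs_self M]

/-- A nonnegative quadratic on `[0, 1]` vanishing at an interior point has a double zero there. -/
lemma deriv_eq_zero_of_nonneg {A B C p : ℝ} (hp : p ∈ Ioo (0 : ℝ) 1)
    (h0 : A + B * p + C * p ^ 2 = 0)
    (h : ∀ m ∈ Icc (0 : ℝ) 1, 0 ≤ A + B * m + C * m ^ 2) : B + 2 * C * p = 0 := by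
  apply le_antisymm
  · refine nonpos_of_forall_mul_le_sq (M := C) hp.1 fun s hs hsp => ?_
    have := h (p - s) ⟨by linarith, by linarith [hp.2]⟩
    linear_combination this + h0
  · rw [← neg_nonpos]
    refine nonpos_of_forall_mul_le_sq (M := C) (sub_pos.2 hp.2) fun s hs hsp => ?_
    have := h (p + s) ⟨by linarith [hp.1], by linarith⟩
    linear_combination this + h0

lemma eq_zero_of_abs_le_sq {d : ℝ × ℝ × ℝ} {p e A : ℝ} (hp : p ∈ Icc (0 : ℝ) 1)
    (hep : e ≠ p) (he : slopePoly d e = 0)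
    (h : ∀ m ∈ Icc (0 : ℝ) 1, |slopePoly d m| ≤ A * (m - p) ^ 2) : d = 0 := by
  obtain ⟨a, b, c⟩ := d
  simp only [slopePoly] at he h
  have h0 : a + b * p ^ 2 + c * p = 0 := by
    have := h p hp
    rw [sub_self] at this
    exact abs_nonpos_iff.1 (by simpa using this)
  have hk : c + 2 * b * p = 0 := by
    rcases le_or_gt p (1 / 2) with hp2 | hp2
    · apply le_antisymm
      · refine nonpos_of_forall_mul_le_sq (M := A - b) one_half_pos fun s hs hs2 => ?_
        have := (abs_le.1 (h (p + s) ⟨by linarith [hp.1], by linarith⟩)).2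
        linear_combination this - h0
      · rw [← neg_nonpos]
        refine nonpos_of_forall_mul_le_sq (M := A + b) one_half_pos fun s hs hs2 => ?_
        have := (abs_le.1 (h (p + s) ⟨by linarith [hp.1], by linarith⟩)).1
        linear_combination this + h0
    · apply le_antisymm
      · refine nonpos_of_forall_mul_le_sq (M := A + b) one_half_pos fun s hs hs2 => ?_
        have := (abs_le.1 (h (p - s) ⟨by linarith, by linarith [hp.2]⟩)).1
        linear_combination this + h0
      · rw [← neg_nonpos]
        refine nonpos_of_forall_mul_le_sq (M := A - b) one_half_pos fun s hs hs2 => ?_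
        have := (abs_le.1 (h (p - s) ⟨by linarith, by linarith [hp.2]⟩)).2
        linear_combination this - h0
  have hb : b = 0 := by
    have : b * (e - p) ^ 2 = 0 := by linear_combination he - h0 - (e - p) * hk
    simpa [sub_eq_zero, hep] using this
  subst hb
  obtain rfl : c = 0 := by linarith
  obtain rfl : a = 0 := by linarith
  rfl

lemma neg_mem_extremePoints_slopeBall {v : ℝ × ℝ × ℝ} (hv : v ∈ slopeBall.extremePoints ℝ) :
    -v ∈ slopeBall.extremePoints ℝ := by
  rw [mem_extremePoints_slopeBall_iff] at hv ⊢
  refine ⟨neg_mem_slopeBall hv.1, fun d h1 h2 => hv.2 d ?_ ?_⟩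
  · simpa only [slopePoly_neg, sub_neg_eq_add] using h2
  · simpa only [slopePoly_neg, ← sub_eq_add_neg] using h1

lemma Pt_mem_extremePoints {t : ℝ} (ht : t ∈ Icc (-1 : ℝ) 1) :
    Pt t ∈ slopeBall.extremePoints ℝ := by
  have hr := Real.sqrt_nonneg (1 + t)
  have hsq := Real.sq_sqrt (by linarith [ht.1] : 0 ≤ 1 + t)
  have ht2 := ht.2
  have hPt : Pt t = (t, 4 + t + 4 * √(1 + t), -2 - 2 * t - 4 * √(1 + t)) := rfl
  generalize √(1 + t) = r at hr hsq hPt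
  obtain rfl : t = r ^ 2 - 1 := by linarith
  rw [hPt]
  have hg : ∀ m, 1 + m ^ 2 + slopePoly (r ^ 2 - 1, 4 + (r ^ 2 - 1) + 4 * r,
      -2 - 2 * (r ^ 2 - 1) - 4 * r) m = (r - (r + 2) * m) ^ 2 := fun m => by
    simp only [slopePoly]; ring
  have hh : ∀ m, 1 + m ^ 2 - slopePoly (r ^ 2 - 1, 4 + (r ^ 2 - 1) + 4 * r,
      -2 - 2 * (r ^ 2 - 1) - 4 * r) m = (1 - m) * (2 - r ^ 2 + ((r + 2) ^ 2 - 2) * m) :=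
    fun m => by simp only [slopePoly]; ring
  rw [mem_extremePoints_slopeBall_iff]
  constructor
  · rintro m ⟨h0, h1⟩
    have hnn : 0 ≤ (1 - m) * (2 - r ^ 2 + ((r + 2) ^ 2 - 2) * m) :=
      mul_nonneg (by linarith) (add_nonneg (by linarith) (mul_nonneg (by nlinarith) h0))
    rw [abs_le]
    constructor
    · linarith [hg m, sq_nonneg (r - (r + 2) * m)]
    · linarith [hh m]
  · intro d h1 h2
    have hp : r / (r + 2) < 1 := by rw [div_lt_one (by positivity)]; linarith
    refine eq_zero_of_abs_le_sq (p := r / (r + 2)) (e := 1) (A := (r + 2) ^ 2)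
      ⟨by positivity, hp.le⟩ hp.ne' ?_ fun m hm => (h1 m hm).trans_eq ?_
    · have := h2 1 ⟨by norm_num, le_rfl⟩
      rw [hh] at this
      exact abs_nonpos_iff.1 (by simpa using this)
    · rw [hg]; field_simp; ring

lemma Qs_mem_extremePoints {s : ℝ} (hs : s ∈ Icc (1 : ℝ) (5 + 4 * √2)) :
    Qs s ∈ slopeBall.extremePoints ℝ := by
  obtain ⟨hs1, hs2⟩ := hs
  have hQ : Qs s = (1, s, -2 * √(2 * (1 + s))) := rfl
  rw [Real.sqrt_mul zero_le_two] at hQ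
  have hr : 0 < √2 := by positivity
  have hrsq := Real.sq_sqrt (zero_le_two : (0 : ℝ) ≤ 2)
  have husq := Real.sq_sqrt (by linarith : 0 ≤ 1 + s)
  have hu := Real.sqrt_nonneg (1 + s)
  generalize √2 = r at *
  generalize √(1 + s) = u at *
  obtain rfl : s = u ^ 2 - 1 := by linarith
  have hru : r ≤ u := by nlinarith
  have hur : u ≤ 2 + r := by nlinarith
  rw [hQ]
  have hg : ∀ m, 1 + m ^ 2 + slopePoly (1, u ^ 2 - 1, -2 * (r * u)) m = (r - u * m) ^ 2 :=
    fun m => by simp only [slopePoly]; linear_combination -hrsq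
  have hh : ∀ m, 1 + m ^ 2 - slopePoly (1, u ^ 2 - 1, -2 * (r * u)) m
      = m * (2 * r * u * (1 - m) + (4 - (u - r) ^ 2) * m) :=
    fun m => by simp only [slopePoly]; linear_combination m ^ 2 * hrsq
  rw [mem_extremePoints_slopeBall_iff]
  constructor
  · rintro m ⟨h0, h1⟩
    have hnn : 0 ≤ m * (2 * r * u * (1 - m) + (4 - (u - r) ^ 2) * m) :=
      mul_nonneg h0 (add_nonneg (mul_nonneg (by positivity) (by linarith))
        (mul_nonneg (by nlinarith) h0))
    rw [abs_le]
    constructor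
    · linarith [hg m, sq_nonneg (r - u * m)]
    · linarith [hh m]
  · intro d h1 h2
    have hupos : 0 < u := hr.trans_le hru
    refine eq_zero_of_abs_le_sq (p := r / u) (e := 0) (A := u ^ 2)
      ⟨by positivity, (div_le_one hupos).2 hru⟩ (by positivity) ?_
      fun m hm => (h1 m hm).trans_eq ?_
    · have := h2 0 ⟨le_rfl, by norm_num⟩
      rw [hh] at this
      exact abs_nonpos_iff.1 (by simpa using this)
    · rw [hg]; field_simp; ring

lemma one_one_zero_mem_extremePoints :
    ((1, 1, 0) : ℝ × ℝ × ℝ) ∈ slopeBall.extremePoints ℝ := by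
  have hf : ∀ m, slopePoly (1, 1, 0) m = 1 + m ^ 2 := fun m => by simp [slopePoly]
  rw [mem_extremePoints_slopeBall_iff]
  refine ⟨fun m _ => by rw [hf, abs_of_nonneg (by positivity)], fun d _ h2 => ?_⟩
  simp only [hf, sub_self] at h2
  exact eq_zero_of_abs_le_sq (p := 0) (e := 1) (A := 0) (by simp) one_ne_zero
    (abs_nonpos_iff.1 (h2 1 (by simp))) (by simpa using h2)

/-- A ball element whose lower gap is `A (m - p)²` and whose upper gap vanishes at `1`. -/
lemma exists_eq_Pt {a b c p : ℝ} (hv : (a, b, c) ∈ slopeBall) (hp : p ∈ Ico (0 : ℝ) 1)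
    (h0 : 1 + a = (1 + b) * p ^ 2) (hc : c + 2 * (1 + b) * p = 0) (h1 : a + b + c = 2) :
    ∃ t ∈ Icc (-1 : ℝ) 1, (a, b, c) = Pt t := by
  obtain ⟨hp0, hp1⟩ := hp
  have ha := abs_le.1 (hv 0 ⟨le_rfl, zero_le_one⟩)
  simp only [slopePoly] at ha
  have hA : (1 + b) * (1 - p) ^ 2 = 4 := by linear_combination h1 - h0 - hc
  have hApos : 0 < 1 + b := by
    by_contra! h
    nlinarith [sq_nonneg (1 - p)]
  obtain ⟨u, hu, hub⟩ : ∃ u : ℝ, 0 < u ∧ u ^ 2 = 1 + b :=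
    ⟨√(1 + b), Real.sqrt_pos.2 hApos, Real.sq_sqrt hApos.le⟩
  have hup : u * (1 - p) = 2 := by
    have : 0 < u * (1 - p) := mul_pos hu (by linarith)
    have hsq : (u * (1 - p)) ^ 2 = 4 := by rw [mul_pow, hub, hA]
    nlinarith
  have hr : √(1 + a) = u - 2 := by
    have : 1 + a = (u * p) ^ 2 := by rw [h0, mul_pow, hub]
    rw [this, Real.sqrt_sq (by positivity)]; linarith
  refine ⟨a, ⟨by linarith, by linarith⟩, ?_⟩
  have hup' : u * p = u - 2 := by linarith
  have ha' : 1 + a = (u - 2) ^ 2 := by rw [h0, ← hub, ← mul_pow, hup']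
  simp only [Pt, hr, Prod.mk.injEq, true_and]
  constructor
  · linear_combination -hub - ha'
  · rw [← hub] at hc
    linear_combination hc - 2 * u * hup' + 2 * ha'

/-- A ball element whose upper gap is `B (m - q)²` and whose lower gap vanishes at `0`. -/
lemma exists_eq_neg_Qs {a b c q : ℝ} (hv : (a, b, c) ∈ slopeBall) (hq : q ∈ Ioc (0 : ℝ) 1)
    (h0 : 1 - a = (1 - b) * q ^ 2) (hc : -c + 2 * (1 - b) * q = 0) (ha : a = -1) :
    ∃ s ∈ Icc (1 : ℝ) (5 + 4 * √2), (a, b, c) = -Qs s := by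
  obtain ⟨hq0, hq1⟩ := hq
  subst ha
  have hB : (1 - b) * q ^ 2 = 2 := by linarith
  have hBpos : 0 < 1 - b := by
    by_contra! h
    nlinarith [sq_nonneg q]
  have hB2 : 2 ≤ 1 - b :=
    hB ▸ mul_le_of_le_one_right hBpos.le (pow_le_one₀ hq0.le hq1)
  have h1 := (abs_le.1 (hv 1 ⟨zero_le_one, le_rfl⟩)).1
  simp only [slopePoly] at h1
  have hr : √(2 * (1 + -b)) = (1 - b) * q := by
    rw [show 2 * (1 + -b) = ((1 - b) * q) ^ 2 by linear_combination -(1 - b) * hB]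
    exact Real.sqrt_sq (by positivity)
  refine ⟨-b, ⟨by linarith, ?_⟩, ?_⟩
  · obtain ⟨u, hu, hub⟩ : ∃ u : ℝ, 0 < u ∧ u ^ 2 = 1 - b :=
      ⟨√(1 - b), Real.sqrt_pos.2 hBpos, Real.sq_sqrt hBpos.le⟩
    have hr2 : √2 = u * q := by
      rw [← hB, ← hub, ← mul_pow, Real.sqrt_sq (by positivity)]
    have hrsq := Real.sq_sqrt (zero_le_two : (0 : ℝ) ≤ 2)
    have hr0 := Real.sqrt_nonneg 2
    have hle : (u - √2) ^ 2 ≤ 2 ^ 2 := by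
      have : (1 - b) * q = u * √2 := by rw [← hub, hr2]; ring
      nlinarith
    have hle' := abs_le_of_sq_le_sq' hle zero_le_two
    nlinarith
  · simp only [Qs, hr, Prod.neg_mk, Prod.mk.injEq]
    refine ⟨trivial, by ring, by linarith⟩

/-- Classification when the lower gap has a zero to the left of a zero of the upper gap. -/
lemma eq_Pt_or_eq_neg_Qs_of_zeros {v : ℝ × ℝ × ℝ} (hv : v ∈ slopeBall.extremePoints ℝ)
    {p q : ℝ} (hp : p ∈ Icc (0 : ℝ) 1) (hq : q ∈ Icc (0 : ℝ) 1) (hpq : p < q)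
    (hgp : 1 + p ^ 2 + slopePoly v p = 0) (hhq : 1 + q ^ 2 - slopePoly v q = 0) :
    (∃ t ∈ Icc (-1 : ℝ) 1, v = Pt t) ∨ ∃ s ∈ Icc (1 : ℝ) (5 + 4 * √2), v = -Qs s := by
  obtain ⟨a, b, c⟩ := v
  have hball := hv.1
  have hg : ∀ m ∈ Icc (0 : ℝ) 1, 0 ≤ (1 + a) + c * m + (1 + b) * m ^ 2 := fun m hm => by
    have := abs_le.1 (hball m hm); simp only [slopePoly] at this; linarith
  have hh : ∀ m ∈ Icc (0 : ℝ) 1, 0 ≤ (1 - a) + -c * m + (1 - b) * m ^ 2 := fun m hm => by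
    have := abs_le.1 (hball m hm); simp only [slopePoly] at this; linarith
  simp only [slopePoly] at hgp hhq
  have hgd : 0 < p → c + 2 * (1 + b) * p = 0 := fun h =>
    deriv_eq_zero_of_nonneg ⟨h, hpq.trans_le hq.2⟩ (by linarith) hg
  have hhd : q < 1 → -c + 2 * (1 - b) * q = 0 := fun h =>
    deriv_eq_zero_of_nonneg ⟨hp.1.trans_lt hpq, h⟩ (by linarith) hh
  have left : q = 1 → c + 2 * (1 + b) * p = 0 → ∃ t ∈ Icc (-1 : ℝ) 1, (a, b, c) = Pt t := by
    rintro rfl hc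
    exact exists_eq_Pt hball ⟨hp.1, hpq⟩ (by linear_combination hgp - p * hc) hc (by linarith)
  have right : p = 0 → -c + 2 * (1 - b) * q = 0 →
      ∃ s ∈ Icc (1 : ℝ) (5 + 4 * √2), (a, b, c) = -Qs s := by
    rintro rfl hc
    exact exists_eq_neg_Qs hball ⟨hpq, hq.2⟩ (by linear_combination hhq - q * hc) hc (by linarith)
  rcases hp.1.eq_or_lt with hp0 | hp0
  · rcases hq.2.eq_or_lt with hq1 | hq1
    · by_cases hc : c + 2 * (1 + b) * p = 0
      · exact Or.inl (left hq1 hc)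
      by_cases hc' : -c + 2 * (1 - b) * q = 0
      · exact Or.inr (right hp0.symm hc')
      exfalso
      subst hq1
      subst hp0
      obtain rfl : a = -1 := by linarith
      obtain rfl : c = 3 - b := by linarith
      have hb3 : b < 3 := by
        refine lt_of_le_of_ne ?_ fun h => hc (by linarith)
        rw [← sub_nonpos]
        refine nonpos_of_forall_mul_le_sq (M := 1 + b) one_pos fun s hs hs1 => ?_
        have := hg s ⟨hs.le, hs1⟩
        linear_combination this
      have hb5 : -1 < b := by
        refine lt_of_le_of_ne ?_ fun h => hc' (by linarith)
        rw [← sub_nonpos]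
        refine nonpos_of_forall_mul_le_sq (M := 1 - b) one_pos fun s hs hs1 => ?_
        have := hh (1 - s) ⟨by linarith, by linarith⟩
        linear_combination this
      have hd := eq_zero_of_abs_le_gap hv (0, -1, 1) (1 / min (3 - b) 4) (1 / min 2 (1 + b))
        (fun m hm => by
          have hpos : 0 < min (3 - b) 4 := lt_min (by linarith) (by norm_num)
          have h3 := min_le_left (3 - b) 4
          have h4 := min_le_right (3 - b) 4
          obtain ⟨hm0, hm1⟩ := hm
          rw [one_div, ← div_eq_inv_mul, le_div_iff₀ hpos, abs_of_nonneg] <;>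
            simp only [slopePoly]
          · generalize min (3 - b) 4 = e at *
            have : e * (1 - m) ≤ (3 - b) * (1 - m) + 4 * m := by nlinarith
            nlinarith [mul_le_mul_of_nonneg_left this hm0]
          · nlinarith)
        (fun m hm => by
          have hpos : 0 < min 2 (1 + b) := lt_min (by norm_num) (by linarith)
          have h3 := min_le_left 2 (1 + b)
          have h4 := min_le_right 2 (1 + b)
          obtain ⟨hm0, hm1⟩ := hm
          rw [one_div, ← div_eq_inv_mul, le_div_iff₀ hpos, abs_of_nonneg] <;>
            simp only [slopePoly]
          · generalize min 2 (1 + b) = e at *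
            have : e * m ≤ 2 * (1 - m) + (1 + b) * m := by nlinarith
            nlinarith [mul_le_mul_of_nonneg_left this (sub_nonneg.2 hm1)]
          · nlinarith)
      simp at hd
    · exact Or.inr (right hp0.symm (hhd hq1))
  · rcases hq.2.eq_or_lt with hq1 | hq1
    · exact Or.inl (left hq1 (hgd hp0))
    · exfalso
      have h1 := hgd hp0
      have h2 := hhd hq1
      have hA : (1 + b) * p ^ 2 = 1 + a := by linear_combination p * h1 - hgp
      have hB : (1 - b) * q ^ 2 = 1 - a := by linear_combination q * h2 - hhq
      have ha := hg 0 (by simp)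
      have ha' := hh 0 (by simp)
      have hq0 := hp0.trans hpq
      have hA' : 0 ≤ 1 + b := by
        by_contra! h
        nlinarith [mul_pos hp0 hp0]
      have hB' : 0 ≤ 1 - b := by
        by_contra! h
        nlinarith [mul_pos hq0 hq0]
      nlinarith [mul_nonneg hA' hp0.le, mul_nonneg hB' hp0.le]

lemma exists_gap_zero_or_eq {v : ℝ × ℝ × ℝ} (hv : v ∈ slopeBall.extremePoints ℝ) :
    (∃ q ∈ Icc (0 : ℝ) 1, 1 + q ^ 2 - slopePoly v q = 0) ∨ v = (-1, -1, 0) := by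
  by_contra! ⟨hne, hv'⟩
  have hpos : ∀ m ∈ Icc (0 : ℝ) 1, 0 < 1 + m ^ 2 - slopePoly v m := fun m hm =>
    lt_of_le_of_ne (by linarith [(abs_le.1 (hv.1 m hm)).2]) (hne m hm).symm
  have hd : ∀ m, slopePoly (v + (1, 1, 0)) m = 1 + m ^ 2 + slopePoly v m := fun m => by
    rw [slopePoly_add]; simp only [slopePoly]; ring
  obtain ⟨C, hC⟩ := exists_abs_le_mul_of_pos (continuous_slopePoly (v + (1, 1, 0)))
    (g := fun m => 1 + m ^ 2 - slopePoly v m)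
    ((continuous_const.add (continuous_pow 2)).sub (continuous_slopePoly v)) hpos
  refine hv' ?_
  have := eq_zero_of_abs_le_gap hv (v + (1, 1, 0)) 1 C (fun m hm => ?_) hC
  · rw [eq_neg_of_add_eq_zero_left this]; simp
  · rw [hd, one_mul, abs_of_nonneg]
    linarith [(abs_le.1 (hv.1 m hm)).1]

theorem stmt_1 :
    Set.extremePoints ℝ {v : ℝ × ℝ × ℝ | secNorm v.1 v.2.1 v.2.2 ≤ 1} =
      {v | ∃ t ∈ Set.Icc (-1 : ℝ) 1, v = Pt t} ∪
      {v | ∃ t ∈ Set.Icc (-1 : ℝ) 1, v = -Pt t} ∪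
      {v | ∃ s ∈ Set.Icc (1 : ℝ) (5 + 4 * Real.sqrt 2), v = Qs s} ∪
      {v | ∃ s ∈ Set.Icc (1 : ℝ) (5 + 4 * Real.sqrt 2), v = -Qs s} ∪
      {((1 : ℝ), (1 : ℝ), (0 : ℝ)), ((-1 : ℝ), (-1 : ℝ), (0 : ℝ))} := by
  have hball : {v : ℝ × ℝ × ℝ | secNorm v.1 v.2.1 v.2.2 ≤ 1} = slopeBall :=
    Set.ext secNorm_le_one_iff
  rw [hball]
  have hneg : ((-1, -1, 0) : ℝ × ℝ × ℝ) = -(1, 1, 0) := by simp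
  ext v
  simp only [mem_union, mem_ofPred_eq, mem_insert_iff, mem_singleton_iff]
  constructor
  · intro hv
    have hv' := neg_mem_extremePoints_slopeBall hv
    rcases exists_gap_zero_or_eq hv with ⟨q, hq, hhq⟩ | h
    swap
    · simp [h]
    rcases exists_gap_zero_or_eq hv' with ⟨p, hp, hgp⟩ | h
    swap
    · rw [hneg, neg_inj] at h
      simp [h]
    rw [slopePoly_neg, sub_neg_eq_add] at hgp
    rcases lt_trichotomy p q with hpq | rfl | hpq
    · rcases eq_Pt_or_eq_neg_Qs_of_zeros hv hp hq hpq hgp hhq with h | h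
      · exact Or.inl (Or.inl (Or.inl (Or.inl h)))
      · exact Or.inl (Or.inr h)
    · nlinarith [sq_nonneg p]
    · have := eq_Pt_or_eq_neg_Qs_of_zeros hv' hq hp hpq
        (by rwa [slopePoly_neg, ← sub_eq_add_neg]) (by rwa [slopePoly_neg, sub_neg_eq_add])
      simp only [neg_eq_iff_eq_neg, neg_neg] at this
      rcases this with h | h
      · exact Or.inl (Or.inl (Or.inl (Or.inr h)))
      · exact Or.inl (Or.inl (Or.inr h))
  · rintro ((((⟨t, ht, rfl⟩ | ⟨t, ht, rfl⟩) | ⟨s, hs, rfl⟩) | ⟨s, hs, rfl⟩) | rfl | rfl)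
    · exact Pt_mem_extremePoints ht
    · exact neg_mem_extremePoints_slopeBall (Pt_mem_extremePoints ht)
    · exact Qs_mem_extremePoints hs
    · exact neg_mem_extremePoints_slopeBall (Qs_mem_extremePoints hs)
    · exact one_one_zero_mem_extremePoints
    · rw [hneg]
      exact neg_mem_extremePoints_slopeBall one_one_zero_mem_extremePoints
end
end

section
/- For every (x,y) ∈ D(π/4) and every (a,b,c) ∈ ℝ³, the square of the Euclidean length of the gradient satisfies ‖∇P_{a,b,c}(x,y)‖₂² ≤ Φ(x,y)·‖(a,b,c)‖². -/
open Real Set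

noncomputable section

/-- The optimal Bernstein factor Φ for the squared Euclidean gradient length. -/
def Phi (x y : ℝ) : ℝ :=
  if (0 ≤ y ∧ y ≤ (Real.sqrt 2 - 1) / 2 * x) ∨ ((4 * Real.sqrt 2 - 5) * x ≤ y ∧ y ≤ x) then
    4 * ((13 + 8 * Real.sqrt 2) * x ^ 2 + (69 + 48 * Real.sqrt 2) * y ^ 2
      - 2 * (28 + 20 * Real.sqrt 2) * x * y)
  else if y ≤ (Real.sqrt 2 - 1) * x then
    x ^ 4 / y ^ 2 + 4 * (x ^ 2 + y ^ 2)
  else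
    (3 * x ^ 2 - 2 * x * y + 3 * y ^ 2) ^ 2 / (2 * (x - y) ^ 2)

/-- The bounds on `Ψ` from which `‖∇P(x,y)‖² ≤ 4(x²+y²) + Ψ` follows for every `P` of norm at most
one: the first two come from polynomials touching `±1` inside the sector, the last two from
polynomials that are monotone on its arc. -/
def IsGradMajorant (x y Ψ : ℝ) : Prop :=
  (∀ k : ℝ, 1 ≤ k → k ≤ 1 + √2 →
    16 * k ^ 2 * (x - y * k) ^ 2 ≤ Ψ ∧ 8 * k ^ 2 * (x + y - (x - y) * k) ^ 2 ≤ Ψ) ∧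
  32 * y ^ 2 ≤ Ψ ∧ 16 * (x - y) ^ 2 ≤ Ψ

/-- The reflection of the sector in its bisector preserves majorants. -/
lemma IsGradMajorant.of_reflect {x y Ψ : ℝ} (h : IsGradMajorant (x + y) (x - y) (2 * Ψ)) :
    IsGradMajorant x y Ψ := by
  obtain ⟨h1, h2, h3⟩ := h
  refine ⟨fun k hk hk' => ?_, by linarith, by linarith⟩
  obtain ⟨h4, h5⟩ := h1 k hk hk'
  constructor <;> linarith

lemma isGradMajorant_of_le {x y : ℝ} (hy : 0 ≤ y) (h : 2 * (1 + √2) * y ≤ x) :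
    IsGradMajorant x y (16 * (1 + √2) ^ 2 * (x - (1 + √2) * y) ^ 2) := by
  have hs : √2 ^ 2 = 2 := Real.sq_sqrt (by norm_num)
  have hs1 : 1.4 ≤ √2 := Real.le_sqrt_of_sq_le (by norm_num)
  set s := √2
  have hx : 0 ≤ x := le_trans (by positivity) h
  have hxy : x ≤ 2 * (x - (1 + s) * y) := by linarith
  have hlow : 2.4 * (x / 2) ≤ (1 + s) * (x - (1 + s) * y) := by
    apply mul_le_mul <;> linarith
  have hyx : 2.4 * y ≤ x / 2 := by nlinarith
  refine ⟨fun k hk hk' => ⟨?_, ?_⟩, ?_, ?_⟩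
  · have h0 : 0 ≤ k * (x - y * k) := mul_nonneg (by linarith) (by nlinarith)
    have h1 : k * (x - y * k) ≤ (1 + s) * (x - (1 + s) * y) := by
      have : 0 ≤ (1 + s - k) * (x - y * (1 + s + k)) :=
        mul_nonneg (by linarith) (by nlinarith)
      linarith
    nlinarith [pow_le_pow_left₀ h0 h1 2]
  · have h1 : k * (x + y - (x - y) * k) ≤ s * ((1 + s) * (x - (1 + s) * y)) := by
      have e1 : k * (x + y - (x - y) * k) ≤ k * (2 * y) :=
        mul_le_mul_of_nonneg_left (by nlinarith) (by linarith)
      have e2 : k * (2 * y) ≤ (1 + s) * (2 * y) :=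
        mul_le_mul_of_nonneg_right hk' (by linarith)
      nlinarith
    have h2 : -(s * ((1 + s) * (x - (1 + s) * y))) ≤ k * (x + y - (x - y) * k) := by
      have e : (x - y) * (1 + s) - (x + y) = s * (x - (1 + s) * y) := by linear_combination y * hs
      have e1 : (x - y) * k - (x + y) ≤ s * (x - (1 + s) * y) := by
        rw [← e]; nlinarith
      have e2 : k * ((x - y) * k - (x + y)) ≤ k * (s * (x - (1 + s) * y)) :=
        mul_le_mul_of_nonneg_left e1 (by linarith)
      have e3 : k * (s * (x - (1 + s) * y)) ≤ (1 + s) * (s * (x - (1 + s) * y)) :=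
        mul_le_mul_of_nonneg_right hk' (mul_nonneg (by linarith) (by linarith))
      linarith
    have h3 := sq_le_sq' h2 h1
    rw [mul_pow, mul_pow s, hs] at h3
    linarith [mul_pow (1 + s) (x - (1 + s) * y) 2]
  · have := pow_le_pow_left₀ (by positivity) (show 2 * y ≤ (1 + s) * (x - (1 + s) * y) by linarith) 2
    nlinarith
  · have := pow_le_pow_left₀ (show 0 ≤ x - y by linarith)
      (show x - y ≤ (1 + s) * (x - (1 + s) * y) by linarith) 2
    linarith [mul_pow (1 + s) (x - (1 + s) * y) 2]

lemma isGradMajorant_of_ge {x y : ℝ} (hy : 0 < y) (h : (1 + √2) * y ≤ x) :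
    IsGradMajorant x y (x ^ 4 / y ^ 2) := by
  have hs : √2 ^ 2 = 2 := Real.sq_sqrt (by norm_num)
  have hs1 : 1.4 ≤ √2 := Real.le_sqrt_of_sq_le (by norm_num)
  set s := √2
  have hx : 0 < x := lt_of_lt_of_le (by positivity) h
  have hy2 : 0 < y ^ 2 := by positivity
  have hyx : s * y ≤ x - y := by linarith
  have hxy : 0 < x - y := lt_of_lt_of_le (by positivity) hyx
  refine ⟨fun k hk hk' => ⟨?_, ?_⟩, ?_, ?_⟩ <;> rw [le_div_iff₀ hy2]
  · have h0 : 0 ≤ 4 * y * (k * (x - y * k)) :=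
      mul_nonneg (by linarith) (mul_nonneg (by linarith) (by nlinarith))
    have h1 : 4 * y * (k * (x - y * k)) ≤ x ^ 2 := by nlinarith [sq_nonneg (x - 2 * y * k)]
    linarith [pow_le_pow_left₀ h0 h1 2]
  · have h1 : 2 * s * y * (k * (x + y - (x - y) * k)) ≤ x ^ 2 := by
      have e1 : 4 * (x - y) * (k * (x + y - (x - y) * k)) ≤ (x + y) ^ 2 := by
        nlinarith [sq_nonneg (x + y - 2 * (x - y) * k)]
      have e2 : (x + y) ^ 2 ≤ 2 * x ^ 2 := by
        have : x + y ≤ s * x := by nlinarith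
        have := pow_le_pow_left₀ (by positivity) this 2
        rwa [mul_pow, hs] at this
      have e3 : s * y * (x + y) ^ 2 ≤ (x - y) * (2 * x ^ 2) :=
        mul_le_mul hyx e2 (by positivity) hxy.le
      have e4 := mul_le_mul_of_nonneg_left e1 (show 0 ≤ s * y by positivity)
      refine le_of_mul_le_mul_left ?_ hxy
      linarith
    have h2 : -x ^ 2 ≤ 2 * s * y * (k * (x + y - (x - y) * k)) := by
      have e : (x - y) * (1 + s) - (x + y) = s * (x - (1 + s) * y) := by linear_combination y * hs
      have e1 : (x - y) * k - (x + y) ≤ s * (x - (1 + s) * y) := by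
        rw [← e]; nlinarith
      have e2 : k * ((x - y) * k - (x + y)) ≤ k * (s * (x - (1 + s) * y)) :=
        mul_le_mul_of_nonneg_left e1 (by linarith)
      have e3 : k * (s * (x - (1 + s) * y)) ≤ (1 + s) * (s * (x - (1 + s) * y)) :=
        mul_le_mul_of_nonneg_right hk' (mul_nonneg (by linarith) (by linarith))
      have e4 := mul_le_mul_of_nonneg_left (e2.trans e3) (show 0 ≤ 2 * s * y by positivity)
      have e5 : 2 * s * y * ((1 + s) * (s * (x - (1 + s) * y)))
          = 4 * (y * (1 + s)) * (x - (y * (1 + s))) := by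
        linear_combination 2 * y * (1 + s) * (x - (1 + s) * y) * hs
      nlinarith [sq_nonneg (x - 2 * (y * (1 + s)))]
    have h3 := sq_le_sq' (by linarith) h1
    have e : (2 * s * y * (k * (x + y - (x - y) * k))) ^ 2
        = 8 * k ^ 2 * (x + y - (x - y) * k) ^ 2 * y ^ 2 := by
      linear_combination 4 * k ^ 2 * (x + y - (x - y) * k) ^ 2 * y ^ 2 * hs
    linarith
  · have h1 : 2.4 * y ≤ x := by nlinarith
    have := pow_le_pow_left₀ (by positivity) h1 4
    nlinarith [show 0 < y ^ 4 by positivity]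
  · have h1 : 4 * (x - y) * y ≤ x ^ 2 := by nlinarith [sq_nonneg (x - 2 * y)]
    have := pow_le_pow_left₀ (by positivity) h1 2
    linarith

/-- Some majorant `Ψ` satisfies `Φ = 4(x²+y²) + Ψ`. -/
lemma isGradMajorant_Phi {x y : ℝ} (hy : 0 ≤ y) (hyx : y ≤ x) :
    IsGradMajorant x y (Phi x y - 4 * (x ^ 2 + y ^ 2)) := by
  have hs : √2 ^ 2 = 2 := Real.sq_sqrt (by norm_num)
  have hs1 : 1.4 ≤ √2 := Real.le_sqrt_of_sq_le (by norm_num)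
  have hs4 : √2 ^ 4 = 4 := by rw [show √2 ^ 4 = (√2 ^ 2) ^ 2 by ring, hs]; norm_num
  have hs3 : √2 ^ 3 = 2 * √2 := by rw [pow_succ, hs]
  unfold Phi
  split_ifs with h h'
  · rcases h with h | h
    · convert isGradMajorant_of_le hy (x := x) ?_ using 1
      · ring_nf
        simp only [hs, hs3, hs4]
        ring
      · have := mul_le_mul_of_nonneg_left h.2 (show 0 ≤ 2 * (1 + √2) by positivity)
        linarith [show 2 * (1 + √2) * ((√2 - 1) / 2 * x) = x by linear_combination x * hs]
    · apply IsGradMajorant.of_reflect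
      convert isGradMajorant_of_le (x := x + y) (y := x - y) (by linarith) ?_ using 1
      · ring_nf
        simp only [hs, hs3, hs4]
        ring
      · have := mul_le_mul_of_nonneg_left h.1 (show 0 ≤ 3 + 2 * √2 by positivity)
        linarith [show (3 + 2 * √2) * ((4 * √2 - 5) * x) = (1 + 2 * √2) * x by
          linear_combination 8 * x * hs]
  · have hy' : 0 < y := by
      rcases hy.lt_or_eq with h0 | h0
      · exact h0
      · refine absurd (Or.inl ⟨hy, ?_⟩) h
        rw [← h0]
        exact mul_nonneg (by linarith) (by linarith)
    rw [add_sub_cancel_right]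
    refine isGradMajorant_of_ge hy' ?_
    have := mul_le_mul_of_nonneg_left h' (show 0 ≤ 1 + √2 by positivity)
    linarith [show (1 + √2) * ((√2 - 1) * x) = x by linear_combination x * hs]
  · have hxy : 0 < x - y := by
      by_contra! h0
      refine h (Or.inr ⟨?_, hyx⟩)
      have : x = y := by linarith
      subst this
      nlinarith
    apply IsGradMajorant.of_reflect
    convert isGradMajorant_of_ge (x := x + y) hxy ?_ using 1
    · field_simp
      ring
    · have := mul_le_mul_of_nonneg_left (not_le.mp h').le (show 0 ≤ 2 + √2 by positivity)
      linarith [show (2 + √2) * ((√2 - 1) * x) = √2 * x by linear_combination x * hs]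

lemma secNorm_nonneg (a b c : ℝ) : 0 ≤ secNorm a b c := by
  apply Real.sSup_nonneg
  rintro _ ⟨p, -, rfl⟩
  exact abs_nonneg _

/-- The supremum defining `secNorm` bounds the polynomial on the cone over the sector. -/
lemma abs_le_secNorm (a b c : ℝ) {u v : ℝ} (hv : 0 ≤ v) (hvu : v ≤ u) :
    |a * u ^ 2 + b * v ^ 2 + c * u * v| ≤ secNorm a b c * (u ^ 2 + v ^ 2) := by
  have hbdd : BddAbove
      ((fun p : ℝ × ℝ => |a * p.1 ^ 2 + b * p.2 ^ 2 + c * p.1 * p.2|) '' sector) := by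
    refine ⟨|a| + |b| + |c|, ?_⟩
    rintro _ ⟨⟨u, v⟩, ⟨h1, h2, h3⟩, rfl⟩
    simp only at h1 h2 h3 ⊢
    have e1 : |a * u ^ 2| ≤ |a| := by
      rw [abs_mul, abs_of_nonneg (sq_nonneg u)]
      exact mul_le_of_le_one_right (abs_nonneg a) (by nlinarith)
    have e2 : |b * v ^ 2| ≤ |b| := by
      rw [abs_mul, abs_of_nonneg (sq_nonneg v)]
      exact mul_le_of_le_one_right (abs_nonneg b) (by nlinarith)
    have e3 : |c * u * v| ≤ |c| := by
      rw [mul_assoc, abs_mul, abs_of_nonneg (mul_nonneg (h1.trans h2) h1)]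
      exact mul_le_of_le_one_right (abs_nonneg c) (by nlinarith [sq_nonneg (u - v)])
    exact (abs_add_three _ _ _).trans (by linarith)
  rcases (hv.trans hvu).lt_or_eq with hu | hu
  · have hr : 0 < u ^ 2 + v ^ 2 := by positivity
    set r := √(u ^ 2 + v ^ 2)
    have hrp : 0 < r := Real.sqrt_pos.mpr hr
    have hr2 : r ^ 2 = u ^ 2 + v ^ 2 := Real.sq_sqrt hr.le
    have hmem : (u / r, v / r) ∈ sector := by
      refine ⟨by positivity, by simp only; gcongr, ?_⟩
      simp only [div_pow]
      rw [← add_div, hr2, div_self hr.ne']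
    have := le_csSup hbdd (mem_image_of_mem _ hmem)
    have e : a * (u / r) ^ 2 + b * (v / r) ^ 2 + c * (u / r) * (v / r)
        = (a * u ^ 2 + b * v ^ 2 + c * u * v) / r ^ 2 := by
      field_simp
    simp only [e, hr2] at this
    rwa [abs_div, abs_of_pos hr, div_le_iff₀ hr] at this
  · have hv0 : v = 0 := by linarith
    simp [← hu, hv0]

/-- The gradient bound for polynomials that are monotone along the arc. -/
lemma gradSq_le_of_monotone {x y Ψ a b c N : ℝ} (hΨ : IsGradMajorant x y Ψ)
    (hab : b ≤ a) (hc : c ≤ 0) (ha : a ≤ N) (hd : -2 * N ≤ a + b + c) :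
    (2 * a * x + c * y) ^ 2 + (2 * b * y + c * x) ^ 2 ≤ (4 * (x ^ 2 + y ^ 2) + Ψ) * N ^ 2 := by
  obtain ⟨-, h1, h2⟩ := hΨ
  obtain ⟨l₁, rfl⟩ : ∃ l, a = N - l := ⟨N - a, by ring⟩
  obtain ⟨l₃, rfl⟩ : ∃ l, b = N - l₁ - 2 * l := ⟨(N - l₁ - b) / 2, by ring⟩
  obtain ⟨l₄, rfl⟩ : ∃ l, c = -2 * l := ⟨-c / 2, by ring⟩
  obtain ⟨l₂, hl₂⟩ : ∃ l, N = (l₁ + l + l₃ + l₄) / 2 := ⟨2 * N - l₁ - l₃ - l₄, by ring⟩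
  have p1 : 0 ≤ l₁ := by linarith
  have p3 : 0 ≤ l₃ := by linarith
  have p4 : 0 ≤ l₄ := by linarith
  have p2 : 0 ≤ l₂ := by linarith
  subst hl₂
  have hΨ0 : 0 ≤ Ψ := le_trans (by positivity) h1
  have hS : 0 ≤ l₁ + l₂ + l₃ + l₄ := by positivity
  have q1 := mul_le_mul_of_nonneg_left h1 (mul_nonneg hS p3)
  have q2 := mul_le_mul_of_nonneg_left h2 (mul_nonneg hS p4)
  have q3 := mul_nonneg (mul_nonneg hS (add_nonneg p1 p2)) hΨ0
  have q4 : 0 ≤ l₁ * l₂ * (16 * (x ^ 2 + y ^ 2)) := by positivity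
  have q5 : 0 ≤ l₂ * l₃ * (64 * y ^ 2) := by positivity
  have q6 : 0 ≤ l₂ * l₄ * (16 * (x ^ 2 + y ^ 2)) := by positivity
  have q7 : 0 ≤ l₁ * l₃ * (16 * (x ^ 2 + y ^ 2)) := by positivity
  have q8 : 0 ≤ l₁ * l₄ * (32 * (x - y) ^ 2) := by positivity
  have q9 : 0 ≤ l₃ * l₄ * (16 * y ^ 2 + (4 * x - 8 * y) ^ 2) := by positivity
  linarith

/-- The gradient bound for `P = A(u²+v²) - R(p(u²-v²) + 2quv)`, given a bound at the endpoint
where `u²-v²` is maximal. Here `r = x²+y²` and `D` measures the distance to the touching point. -/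
lemma touching_bound {A R N p r D Ψ : ℝ} (hR : 0 ≤ R) (hN : 0 ≤ N) (hp : 0 ≤ p) (hp1 : p < 1)
    (hm : |A - R| ≤ N) (he : A - R * p ≤ N) (hr : 0 ≤ r) (hD : 0 ≤ D) (hΨ0 : 0 ≤ Ψ)
    (hΨ : 16 * (1 + p) * D ≤ Ψ * (1 - p) ^ 2) :
    4 * ((A - R) ^ 2 * r + 2 * (A * R) * D) ≤ (4 * r + Ψ) * N ^ 2 := by
  have hm2 : (A - R) ^ 2 * r ≤ N ^ 2 * r :=
    mul_le_mul_of_nonneg_right (sq_le_sq.mpr (by rwa [abs_of_nonneg hN])) hr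
  obtain ⟨hm1, hm3⟩ := abs_le.mp hm
  rcases le_total A 0 with hA | hA
  · have : A * R * D ≤ 0 :=
      mul_nonpos_of_nonpos_of_nonneg (mul_nonpos_of_nonpos_of_nonneg hA hR) hD
    nlinarith [mul_nonneg hΨ0 (sq_nonneg N)]
  · have hw : 0 < 1 - p := by linarith
    have h1 : (1 - p) * R ≤ 2 * N := by linarith
    have h2 : (1 - p) * A ≤ (1 + p) * N := by nlinarith
    have h3 : (1 - p) * R * ((1 - p) * A) ≤ 2 * N * ((1 + p) * N) :=
      mul_le_mul h1 h2 (by positivity) (by positivity)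
    have h4 : 8 * (A * R) * D ≤ Ψ * N ^ 2 := by
      refine le_of_mul_le_mul_left ?_ (show 0 < (1 - p) ^ 2 by positivity)
      have h5 := mul_le_mul_of_nonneg_right h3 hD
      have h6 := mul_le_mul_of_nonneg_right hΨ (sq_nonneg N)
      linarith
    linarith

lemma touching_bound_of_le {x y A R N p q Ψ : ℝ} (hR : 0 ≤ R) (hN : 0 ≤ N) (hp : 0 ≤ p)
    (hpq : p ≤ q) (hpq1 : p ^ 2 + q ^ 2 = 1) (hm : |A - R| ≤ N) (he : A - R * p ≤ N)
    (hΨ : ∀ k : ℝ, 1 ≤ k → k ≤ 1 + √2 → 16 * k ^ 2 * (x - y * k) ^ 2 ≤ Ψ) :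
    4 * ((A - R) ^ 2 * (x ^ 2 + y ^ 2) +
      2 * (A * R) * (x ^ 2 + y ^ 2 - (x ^ 2 - y ^ 2) * p - 2 * x * y * q))
      ≤ (4 * (x ^ 2 + y ^ 2) + Ψ) * N ^ 2 := by
  have hs : √2 ^ 2 = 2 := Real.sq_sqrt (by norm_num)
  have hs0 : 0 ≤ √2 := Real.sqrt_nonneg 2
  have hq : 0 < q := by nlinarith
  have hp1 : p < 1 := by nlinarith
  have hsq : 1 ≤ √2 * q := by
    by_contra! h
    have := pow_lt_pow_left₀ h (by positivity) two_ne_zero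
    rw [mul_pow, hs] at this
    nlinarith
  obtain ⟨k, hk⟩ : ∃ k, k * q = 1 + p := ⟨(1 + p) / q, by field_simp⟩
  have hk2 : k * (1 - p) = q := by
    refine mul_right_cancel₀ hq.ne' ?_
    linear_combination (1 - p) * hk - hpq1
  have hk1 : 1 ≤ k := le_of_mul_le_mul_right (by nlinarith) hq
  have hk3 : k ≤ 1 + √2 := le_of_mul_le_mul_right (by nlinarith) hq
  have hD : x ^ 2 + y ^ 2 - (x ^ 2 - y ^ 2) * p - 2 * x * y * q = (1 - p) * (x - y * k) ^ 2 := by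
    linear_combination (2 * x * y - y ^ 2 * k) * hk2 - y ^ 2 * hk
  have hΨk := hΨ k hk1 hk3
  rw [hD]
  refine touching_bound hR hN hp hp1 hm he (by positivity)
    (mul_nonneg (by linarith) (sq_nonneg _)) (le_trans (by positivity) hΨk) ?_
  have e := mul_le_mul_of_nonneg_right hΨk (sq_nonneg (1 - p))
  have e2 : k ^ 2 * (1 - p) = 1 + p := by linear_combination k * hk2 + hk
  calc 16 * (1 + p) * ((1 - p) * (x - y * k) ^ 2)
      = 16 * k ^ 2 * (x - y * k) ^ 2 * (1 - p) ^ 2 := by rw [← e2]; ring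
    _ ≤ _ := e

/-- The gradient bound for polynomials with a minimum along the arc. -/
lemma gradSq_le_of_touching {x y Ψ a b c : ℝ} (hΨ : IsGradMajorant x y Ψ)
    (hab : a ≤ b) (hc : c ≤ 0) :
    (2 * a * x + c * y) ^ 2 + (2 * b * y + c * x) ^ 2
      ≤ (4 * (x ^ 2 + y ^ 2) + Ψ) * secNorm a b c ^ 2 := by
  have hN := secNorm_nonneg a b c
  have hcone := fun u v : ℝ => @abs_le_secNorm a b c u v
  generalize secNorm a b c = N at hN hcone
  obtain ⟨R, p, q, hR, hp, hq, hpq, hB, hC⟩ : ∃ R p q : ℝ, 0 ≤ R ∧ 0 ≤ p ∧ 0 ≤ q ∧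
      p ^ 2 + q ^ 2 = 1 ∧ (a - b) / 2 = -(R * p) ∧ c / 2 = -(R * q) := by
    have hR2 : √(((b - a) / 2) ^ 2 + (c / 2) ^ 2) ^ 2 = ((b - a) / 2) ^ 2 + (c / 2) ^ 2 :=
      Real.sq_sqrt (by positivity)
    have hR0 := Real.sqrt_nonneg (((b - a) / 2) ^ 2 + (c / 2) ^ 2)
    generalize √(((b - a) / 2) ^ 2 + (c / 2) ^ 2) = R at hR2 hR0
    rcases hR0.lt_or_eq with h | h
    · refine ⟨R, (b - a) / 2 / R, -(c / 2) / R, h.le, div_nonneg (by linarith) h.le,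
        div_nonneg (by linarith) h.le, ?_, ?_, ?_⟩
      · rw [div_pow _ R, div_pow _ R, ← add_div, hR2, neg_sq]
        exact div_self (hR2 ▸ pow_pos h 2).ne'
      · field_simp; ring
      · field_simp
    · subst h
      refine ⟨0, 1, 0, le_rfl, zero_le_one, le_rfl, by norm_num, ?_, ?_⟩ <;> nlinarith
  obtain ⟨A, hA⟩ : ∃ A, A = (a + b) / 2 := ⟨_, rfl⟩
  obtain rfl : a = A - R * p := by linarith
  obtain rfl : b = A + R * p := by linarith
  obtain rfl : c = -2 * (R * q) := by linarith
  have hp1 : p ≤ 1 := by nlinarith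
  have hq1 : q ≤ 1 := by nlinarith
  have h0 : A - R * p ≤ N := by
    have := (abs_le.mp (hcone 1 0 le_rfl zero_le_one)).2
    linarith
  have h1 : A - R * q ≤ N := by
    have := (abs_le.mp (hcone 1 1 zero_le_one le_rfl)).2
    linarith
  have hm : |A - R| ≤ N := by
    have := hcone (1 + p) q hq (by linarith)
    rw [show (A - R * p) * (1 + p) ^ 2 + (A + R * p) * q ^ 2 + -2 * (R * q) * (1 + p) * q
        = (A - R) * (2 * (1 + p)) by
          linear_combination (A + R * p - 2 * R * (1 + p)) * hpq,
      show (1 + p) ^ 2 + q ^ 2 = 2 * (1 + p) by linear_combination hpq, abs_mul,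
      abs_of_pos (show 0 < 2 * (1 + p) by linarith)] at this
    exact le_of_mul_le_mul_right this (by linarith)
  rcases le_total p q with h | h
  · have := touching_bound_of_le hR hN hp h hpq hm h0 fun k hk hk' => (hΨ.1 k hk hk').1
    refine le_of_eq_of_le ?_ this
    linear_combination 4 * R ^ 2 * (x ^ 2 + y ^ 2) * hpq
  · have := touching_bound_of_le (x := x + y) (y := x - y) (Ψ := 2 * Ψ) hR hN hq h
      (by linarith) hm h1 fun k hk hk' => by linarith [(hΨ.1 k hk hk').2]
    refine le_of_mul_le_mul_left (le_of_eq_of_le ?_ (this.trans_eq ?_)) two_pos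
    · linear_combination 8 * R ^ 2 * (x ^ 2 + y ^ 2) * hpq
    · ring

lemma secNorm_neg (a b c : ℝ) : secNorm (-a) (-b) (-c) = secNorm a b c := by
  unfold secNorm
  congr 2 with p
  rw [← abs_neg]
  congr 1
  ring

/-- The gradient bound for non-positive `c`; the other sign follows by negation. -/
lemma gradSq_le_of_nonpos {x y Ψ a b c : ℝ} (hΨ : IsGradMajorant x y Ψ) (hc : c ≤ 0) :
    (2 * a * x + c * y) ^ 2 + (2 * b * y + c * x) ^ 2
      ≤ (4 * (x ^ 2 + y ^ 2) + Ψ) * secNorm a b c ^ 2 := by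
  rcases le_total a b with hab | hab
  · exact gradSq_le_of_touching hΨ hab hc
  · refine gradSq_le_of_monotone hΨ hab hc ?_ ?_
    · have := (abs_le.mp (abs_le_secNorm a b c le_rfl zero_le_one)).2
      linarith
    · have := (abs_le.mp (abs_le_secNorm a b c zero_le_one le_rfl)).1
      linarith

theorem stmt_3 (x y : ℝ) (hxy : (x, y) ∈ sector) (a b c : ℝ) :
    (2 * a * x + c * y) ^ 2 + (2 * b * y + c * x) ^ 2 ≤ Phi x y * (secNorm a b c) ^ 2 := by
  have hΨ := isGradMajorant_Phi hxy.1 hxy.2.1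
  have e : 4 * (x ^ 2 + y ^ 2) + (Phi x y - 4 * (x ^ 2 + y ^ 2)) = Phi x y := by ring
  rcases le_total c 0 with hc | hc
  · have := gradSq_le_of_nonpos (a := a) (b := b) hΨ hc
    rwa [e] at this
  · have := gradSq_le_of_nonpos (a := -a) (b := -b) hΨ (neg_nonpos.mpr hc)
    rw [e, secNorm_neg] at this
    linarith
end
end

section
/- For every (x,y) ∈ D(π/4), Ψ(x,y) = sup{ ‖DP_{a,b,c}(x,y)‖ : (a,b,c) ∈ ℝ³, ‖(a,b,c)‖ ≤ 1 }; that is, Ψ(x,y) is the smallest constant K(x,y) such that ‖DP_{a,b,c}(x,y)‖ ≤ K(x,y)·‖(a,b,c)‖ for all (a,b,c) ∈ ℝ³. -/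
open Real Set

noncomputable section

/-- The sup over the sector of the differential of P_{a,b,c} at (x,y). -/
def diffNorm (a b c x y : ℝ) : ℝ :=
  sSup ((fun q : ℝ × ℝ => |(2 * a * x + c * y) * q.1 + (2 * b * y + c * x) * q.2|) '' sector)

/-- The optimal Bernstein factor Ψ for the sector-sup norm of the differential. -/
def Psi (x y : ℝ) : ℝ :=
  if y < (2 * Real.sqrt 2 - 1) / 7 * x then
    Real.sqrt 2 * ((1 + 2 * Real.sqrt 2) * x - (3 + 2 * Real.sqrt 2) * y)
  else if y < (Real.sqrt 2 - 1) * x then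
    Real.sqrt 2 * (x ^ 2 + 3 * y ^ 2) / (2 * y)
  else if y < (2 - Real.sqrt 2) * x then
    2 * (x + y ^ 2 / (x - y))
  else
    4 * (1 + Real.sqrt 2) * y - 2 * x

/-- The polynomial `a x² + b y² + c x y` is bounded by the squared Euclidean norm on the cone
spanned by the sector. -/
def BoundedOnCone (a b c : ℝ) : Prop :=
  ∀ p q : ℝ, 0 ≤ q → q ≤ p → |a * p ^ 2 + b * q ^ 2 + c * p * q| ≤ p ^ 2 + q ^ 2

/-- Upper bounds of the differential over the sector at `(x, y)`. -/
def DiffBound (a b c x y K : ℝ) : Prop :=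
  ∀ u v : ℝ, (u, v) ∈ sector → |(2 * a * x + c * y) * u + (2 * b * y + c * x) * v| ≤ K

lemma zero_mem_sector : ((0, 0) : ℝ × ℝ) ∈ sector := by
  simp [sector]

lemma sector_nonneg {u v : ℝ} (h : (u, v) ∈ sector) : 0 ≤ u ∧ u ≤ 1 ∧ 0 ≤ v ∧ v ≤ 1 := by
  obtain ⟨h1, h2, h3⟩ := h
  simp only at h1 h2 h3
  refine ⟨by linarith, by nlinarith, h1, by nlinarith⟩

lemma boundedOnCone_of_secNorm_le_one {a b c : ℝ} (h : secNorm a b c ≤ 1) :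
    BoundedOnCone a b c := by
  intro p q hq hqp
  rcases eq_or_lt_of_le (hq.trans hqp) with hp | hp
  · have : q = 0 := by linarith
    simp [← hp, this]
  set r := √(p ^ 2 + q ^ 2) with hr
  have hr2 : r ^ 2 = p ^ 2 + q ^ 2 := sq_sqrt (by positivity)
  have hr0 : 0 < r := sqrt_pos.mpr (by positivity)
  have hmem : (p / r, q / r) ∈ sector := by
    refine ⟨by positivity, div_le_div_of_nonneg_right hqp hr0.le, ?_⟩
    simp only [div_pow, hr2]
    rw [← add_div, div_self (by positivity)]
  have hbdd : BddAbove
      ((fun p : ℝ × ℝ => |a * p.1 ^ 2 + b * p.2 ^ 2 + c * p.1 * p.2|) '' sector) := by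
    refine ⟨|a| + |b| + |c|, ?_⟩
    rintro _ ⟨⟨u, v⟩, huv, rfl⟩
    obtain ⟨hu, hu1, hv, hv1⟩ := sector_nonneg huv
    simp only
    have h1 : |a * u ^ 2| ≤ |a| := by
      rw [abs_mul, abs_of_nonneg (sq_nonneg u)]
      exact mul_le_of_le_one_right (abs_nonneg a) (pow_le_one₀ hu hu1)
    have h2 : |b * v ^ 2| ≤ |b| := by
      rw [abs_mul, abs_of_nonneg (sq_nonneg v)]
      exact mul_le_of_le_one_right (abs_nonneg b) (pow_le_one₀ hv hv1)
    have h3 : |c * u * v| ≤ |c| := by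
      rw [mul_assoc, abs_mul, abs_of_nonneg (mul_nonneg hu hv)]
      exact mul_le_of_le_one_right (abs_nonneg c) (mul_le_one₀ hu1 hv hv1)
    exact (abs_add_three _ _ _).trans (by linarith)
  have hle := (le_csSup hbdd (mem_image_of_mem _ hmem)).trans h
  have key : a * (p / r) ^ 2 + b * (q / r) ^ 2 + c * (p / r) * (q / r)
      = (a * p ^ 2 + b * q ^ 2 + c * p * q) / (p ^ 2 + q ^ 2) := by
    rw [← hr2]
    field_simp
  simp only [key, abs_div] at hle
  rwa [abs_of_pos (by positivity : 0 < p ^ 2 + q ^ 2), div_le_one (by positivity)] at hle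

lemma secNorm_le_one_iff_s7 {a b c : ℝ} : secNorm a b c ≤ 1 ↔ BoundedOnCone a b c := by
  refine ⟨boundedOnCone_of_secNorm_le_one, fun h => ?_⟩
  refine csSup_le ⟨_, mem_image_of_mem _ zero_mem_sector⟩ ?_
  rintro _ ⟨⟨u, v⟩, ⟨h1, h2, h3⟩, rfl⟩
  exact (h u v h1 h2).trans h3

lemma DiffBound.diffNorm_le {a b c x y K : ℝ} (h : DiffBound a b c x y K) :
    diffNorm a b c x y ≤ K := by
  refine csSup_le ⟨_, mem_image_of_mem _ zero_mem_sector⟩ ?_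
  rintro _ ⟨⟨u, v⟩, huv, rfl⟩
  exact h u v huv

lemma DiffBound.le_diffNorm {a b c x y K : ℝ} (h : DiffBound a b c x y K) {u v : ℝ}
    (huv : (u, v) ∈ sector) :
    |(2 * a * x + c * y) * u + (2 * b * y + c * x) * v| ≤ diffNorm a b c x y := by
  refine le_csSup ⟨K, ?_⟩ (mem_image_of_mem
    (fun q : ℝ × ℝ => |(2 * a * x + c * y) * q.1 + (2 * b * y + c * x) * q.2|) huv)
  rintro _ ⟨⟨u, v⟩, huv, rfl⟩
  exact h u v huv

section Reflection

lemma reflection_mem_sector {x y : ℝ} (h : (x, y) ∈ sector) :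
    ((x + y) / √2, (x - y) / √2) ∈ sector := by
  obtain ⟨h1, h2, h3⟩ := h
  simp only at h1 h2 h3
  refine ⟨div_nonneg (by linarith) (by positivity), by simp only; gcongr; linarith, ?_⟩
  simp only [div_pow, sq_sqrt (zero_le_two (α := ℝ))]
  linarith

lemma reflection_reflection_fst (x y : ℝ) : ((x + y) / √2 + (x - y) / √2) / √2 = x := by
  have : √2 ^ 2 = (2 : ℝ) := sq_sqrt zero_le_two
  field_simp
  rw [this]
  ring

lemma reflection_reflection_snd (x y : ℝ) : ((x + y) / √2 - (x - y) / √2) / √2 = y := by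
  have : √2 ^ 2 = (2 : ℝ) := sq_sqrt zero_le_two
  field_simp
  rw [this]
  ring

lemma BoundedOnCone.reflection {a b c : ℝ} (h : BoundedOnCone a b c) :
    BoundedOnCone ((a + b + c) / 2) ((a + b - c) / 2) (a - b) := by
  intro p q hq hqp
  have := h (p + q) (p - q) (by linarith) (by linarith)
  rw [abs_le] at this ⊢
  constructor <;> nlinarith

lemma diffNorm_reflection (a b c x y : ℝ) :
    diffNorm a b c ((x + y) / √2) ((x - y) / √2)
      = diffNorm ((a + b + c) / 2) ((a + b - c) / 2) (a - b) x y := by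
  have hs : √2 ^ 2 = (2 : ℝ) := sq_sqrt zero_le_two
  have key : ∀ u v : ℝ,
      (2 * a * ((x + y) / √2) + c * ((x - y) / √2)) * ((u + v) / √2)
        + (2 * b * ((x - y) / √2) + c * ((x + y) / √2)) * ((u - v) / √2)
      = (2 * ((a + b + c) / 2) * x + (a - b) * y) * u
        + (2 * ((a + b - c) / 2) * y + (a - b) * x) * v := by
    intro u v
    field_simp
    rw [hs]
    ring
  unfold diffNorm
  congr 1
  ext r
  constructor
  · rintro ⟨⟨u, v⟩, huv, rfl⟩
    refine ⟨_, reflection_mem_sector huv, ?_⟩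
    simp only
    rw [← key, reflection_reflection_fst, reflection_reflection_snd]
  · rintro ⟨⟨u, v⟩, huv, rfl⟩
    refine ⟨_, reflection_mem_sector huv, ?_⟩
    simp only
    rw [key]

lemma setOf_diffNorm_reflection (x y : ℝ) :
    {r : ℝ | ∃ a b c : ℝ, secNorm a b c ≤ 1 ∧
        r = diffNorm a b c ((x + y) / √2) ((x - y) / √2)}
      = {r : ℝ | ∃ a b c : ℝ, secNorm a b c ≤ 1 ∧ r = diffNorm a b c x y} := by
  simp only [secNorm_le_one_iff_s7]
  ext r
  constructor
  · rintro ⟨a, b, c, h, rfl⟩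
    exact ⟨_, _, _, h.reflection, diffNorm_reflection a b c x y⟩
  · rintro ⟨a, b, c, h, rfl⟩
    refine ⟨_, _, _, h.reflection, ?_⟩
    rw [diffNorm_reflection]
    congr 1 <;> ring

lemma Psi_reflection {x y : ℝ} (hy : 0 ≤ y) (h : y < (√2 - 1) * x) :
    Psi ((x + y) / √2) ((x - y) / √2) = Psi x y := by
  have hs : √2 ^ 2 = (2 : ℝ) := sq_sqrt zero_le_two
  have hs0 : 0 < √2 := by positivity
  have hs1 : 1 < √2 := one_lt_sqrt_two
  have hs2 : √2 < 3 / 2 := by nlinarith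
  have hx : 0 < x := by
    by_contra! hx
    nlinarith
  have hlt : ¬ (x - y) / √2 < (√2 - 1) * ((x + y) / √2) := by
    rw [mul_div_assoc', not_lt, div_le_div_iff_of_pos_right hs0]
    nlinarith
  have hlt' : ¬ (x - y) / √2 < (2 * √2 - 1) / 7 * ((x + y) / √2) := by
    rw [mul_div_assoc', not_lt, div_le_div_iff_of_pos_right hs0]
    nlinarith
  have hiff : (x - y) / √2 < (2 - √2) * ((x + y) / √2) ↔ (2 * √2 - 1) / 7 * x < y := by
    rw [mul_div_assoc', div_lt_div_iff_of_pos_right hs0]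
    have : (3 - √2) * (y - (2 * √2 - 1) / 7 * x) = (2 - √2) * (x + y) - (x - y) := by
      linear_combination (2 * x / 7) * hs
    have h3 : 0 < 3 - √2 := by linarith
    constructor
    · intro h
      have : 0 < y - (2 * √2 - 1) / 7 * x := pos_of_mul_pos_right (by linarith) h3.le
      linarith
    · intro h
      have := mul_pos h3 (sub_pos.mpr h)
      linarith
  unfold Psi
  rw [if_neg hlt', if_neg hlt]
  rcases lt_trichotomy y ((2 * √2 - 1) / 7 * x) with h1 | h1 | h1
  · rw [if_neg (by rw [hiff]; exact h1.not_gt), if_pos h1]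
    field_simp
    linear_combination (-(1 + 2 * √2) * x + (3 + 2 * √2) * y) * hs
  · rw [if_neg (by rw [hiff]; exact h1.not_gt), if_neg h1.not_lt, if_pos h]
    have hy0 : 0 < y := h1 ▸ mul_pos (by linarith) hx
    have hxy : x = (1 + 2 * √2) * y := by
      rw [h1]
      linear_combination (-4 * x / 7) * hs
    rw [eq_div_iff (by positivity), hxy]
    field_simp
    linear_combination (4 - 4 * √2 - 4 * √2 ^ 2) * hs
  · rw [if_pos (hiff.mpr h1), if_neg h1.not_gt, if_pos h]
    have : 0 < y := lt_trans (mul_pos (by linarith) hx) h1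
    have h2 : (x + y) / √2 - (x - y) / √2 = 2 * y / √2 := by ring
    rw [h2]
    field_simp
    rw [hs]
    ring

end Reflection

section UpperBound

variable {a b c x y : ℝ}

lemma BoundedOnCone.abs_partial_le_of_lt (h : BoundedOnCone a b c) (hy : 0 ≤ y) (hyx : y < x) :
    |2 * a * x + c * y| ≤ 2 * (x + y ^ 2 / (x - y)) := by
  have h1 := abs_le.mp (h (2 * x - y) y hy (by linarith))
  have h2 := abs_le.mp (h y y hy le_rfl)
  have hd : 0 < x - y := sub_pos.mpr hyx
  have e : 2 * (x + y ^ 2 / (x - y)) = ((2 * x - y) ^ 2 + 3 * y ^ 2) / (2 * (x - y)) := by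
    field_simp
    ring
  rw [e, le_div_iff₀ (by positivity), ← abs_of_pos (by positivity : 0 < 2 * (x - y)), ← abs_mul,
    abs_le]
  constructor <;> linarith

lemma BoundedOnCone.abs_partial_le_of_le (h : BoundedOnCone a b c) (hy : 0 ≤ y)
    (hyx : (2 - √2) * x ≤ y) :
    |2 * a * x + c * y| ≤ 4 * (1 + √2) * y - 2 * x := by
  have hs : √2 ^ 2 = (2 : ℝ) := sq_sqrt zero_le_two
  have hs0 : 0 < √2 := by positivity
  have h0 := abs_le.mp (h 1 0 le_rfl zero_le_one)
  have h1 := abs_le.mp (h 1 1 zero_le_one le_rfl)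
  have h2 := abs_le.mp (h (1 + √2) 1 zero_le_one (by linarith))
  have hc : 0 ≤ (2 + √2) * y - 2 * x := by
    have := mul_le_mul_of_nonneg_left hyx (by positivity : 0 ≤ 2 + √2)
    linear_combination this + x * hs
  have hd : 0 ≤ √2 / 2 * y := by positivity
  have e : 2 * a * x + c * y = -((2 + √2) * y - 2 * x) * a
      + (√2 / 2 * y) * ((a * (1 + √2) ^ 2 + b * 1 ^ 2 + c * (1 + √2) * 1)
        - (a * 1 ^ 2 + b * 1 ^ 2 + c * 1 * 1)) := by
    linear_combination (-a * y * (1 + √2 / 2) - c * y / 2) * hs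
  have e' : 4 * (1 + √2) * y - 2 * x = ((2 + √2) * y - 2 * x)
      + (√2 / 2 * y) * (((1 + √2) ^ 2 + 1 ^ 2) + (1 ^ 2 + 1 ^ 2)) := by
    linear_combination (-(1 + √2 / 2) * y) * hs
  rw [e, e', abs_le]
  constructor <;> nlinarith

lemma BoundedOnCone.mul_abs_diagonal_le (h : BoundedOnCone a b c) (hy : 0 ≤ y) (hyx : y ≤ x) :
    y * |(2 * a * x + c * y) + (2 * b * y + c * x)| ≤ x ^ 2 + 3 * y ^ 2 := by
  have h1 := abs_le.mp (h (x + y) (2 * y) (by linarith) (by linarith))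
  have h2 := abs_le.mp (h (x - y) 0 le_rfl (by linarith))
  rw [← abs_of_nonneg hy, ← abs_mul, abs_of_nonneg hy, abs_le]
  constructor <;> linarith

/-- A bound on the first partial derivative that dominates the one along the diagonal bounds
the whole differential over the sector. -/
lemma BoundedOnCone.diffBound (h : BoundedOnCone a b c) (hy : 0 < y) (hyx : y ≤ x) {N : ℝ}
    (hN : |2 * a * x + c * y| ≤ N) (hNx : 2 * (x ^ 2 + y ^ 2) ≤ N * x)
    (hNy : x ^ 2 + 3 * y ^ 2 ≤ √2 * y * N) : DiffBound a b c x y N := by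
  intro u v huv
  obtain ⟨hu, hu1, hv, -⟩ := sector_nonneg huv
  obtain ⟨-, hvu, hr⟩ := huv
  simp only at hvu hr
  have hN0 : 0 ≤ N := (abs_nonneg _).trans hN
  have hP := h x y hy.le hyx
  set A := 2 * a * x + c * y with hA
  set B := 2 * b * y + c * x with hB
  have hAB : |A * x + B * y| ≤ 2 * (x ^ 2 + y ^ 2) := by
    have : A * x + B * y = 2 * (a * x ^ 2 + b * y ^ 2 + c * x * y) := by rw [hA, hB]; ring
    rw [this, abs_mul, abs_two]
    linarith
  rcases le_total (v * x) (u * y) with hw | hw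
  · refine le_of_mul_le_mul_left ?_ hy
    calc y * |A * u + B * v| = |(u * y - v * x) * A + v * (A * x + B * y)| := by
          rw [← abs_of_pos hy, ← abs_mul, abs_of_pos hy]
          congr 1
          ring
      _ ≤ (u * y - v * x) * |A| + v * |A * x + B * y| := by
          refine (abs_add_le _ _).trans_eq ?_
          rw [abs_mul, abs_mul, abs_of_nonneg (sub_nonneg.mpr hw), abs_of_nonneg hv]
      _ ≤ (u * y - v * x) * N + v * (N * x) := by
          have := sub_nonneg.mpr hw
          have := hAB.trans hNx
          gcongr
      _ = y * (u * N) := by ring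
      _ ≤ y * N := by
          gcongr
          exact mul_le_of_le_one_left hN0 hu1
  · have huv2 : u + v ≤ √2 := le_sqrt_of_sq_le (by nlinarith [sq_nonneg (u - v)])
    have hD : y * |A + B| ≤ x ^ 2 + 3 * y ^ 2 := h.mul_abs_diagonal_le hy.le hyx
    have hs : √2 ^ 2 = (2 : ℝ) := sq_sqrt zero_le_two
    have hdiag : (u + v) * |A + B| ≤ 2 * N := by
      have h1 : √2 * |A + B| ≤ 2 * N := by
        refine le_of_mul_le_mul_left ?_ hy
        have := mul_le_mul_of_nonneg_left (hD.trans hNy) (sqrt_nonneg 2)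
        linear_combination this + y * N * hs
      exact (mul_le_mul_of_nonneg_right huv2 (abs_nonneg _)).trans h1
    rcases hyx.eq_or_lt with rfl | hlt
    · have : v = u := le_antisymm hvu (le_of_mul_le_mul_right hw hy)
      subst this
      have e : A * v + B * v = v * (A + B) := by ring
      rw [e, abs_mul, abs_of_nonneg hv]
      linarith
    · have hd : 0 < x - y := sub_pos.mpr hlt
      refine le_of_mul_le_mul_left ?_ (mul_pos hy hd)
      calc y * (x - y) * |A * u + B * v|
          = y * |(v * x - u * y) * (A + B) + (u - v) * (A * x + B * y)| := by
            rw [mul_assoc, ← abs_of_pos hd, ← abs_mul]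
            congr 2
            ring
        _ ≤ y * ((v * x - u * y) * |A + B| + (u - v) * |A * x + B * y|) := by
            refine mul_le_mul_of_nonneg_left ((abs_add_le _ _).trans_eq ?_) hy.le
            rw [abs_mul, abs_mul, abs_of_nonneg (sub_nonneg.mpr hw),
              abs_of_nonneg (sub_nonneg.mpr hvu)]
        _ = (v * x - u * y) * (y * |A + B|) + (u - v) * (y * |A * x + B * y|) := by ring
        _ ≤ (v * x - u * y) * (x ^ 2 + 3 * y ^ 2)
              + (u - v) * ((x ^ 2 + 3 * y ^ 2) * ((x + y) / 2)) := by
            have h3 : y * (2 * (x ^ 2 + y ^ 2)) ≤ (x ^ 2 + 3 * y ^ 2) * ((x + y) / 2) := by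
              have : 0 ≤ (x - y) ^ 3 := by positivity
              linarith
            have h4 := (mul_le_mul_of_nonneg_left hAB hy.le).trans h3
            have h5 := sub_nonneg.mpr hw
            have h6 := sub_nonneg.mpr hvu
            exact add_le_add (mul_le_mul_of_nonneg_left hD h5) (mul_le_mul_of_nonneg_left h4 h6)
        _ = (x - y) * ((x ^ 2 + 3 * y ^ 2) * ((u + v) / 2)) := by ring
        _ ≤ (x - y) * (√2 * y * N * (√2 / 2)) := by
            gcongr
        _ = y * (x - y) * N := by linear_combination ((x - y) * y * N / 2) * hs

lemma BoundedOnCone.diffBound_Psi (h : BoundedOnCone a b c) (hy : 0 < y) (hyx : y ≤ x)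
    (hxy : (√2 - 1) * x ≤ y) : DiffBound a b c x y (Psi x y) := by
  have hs : √2 ^ 2 = (2 : ℝ) := sq_sqrt zero_le_two
  have hs1 : 1.4 < √2 := lt_sqrt_of_sq_lt (by norm_num)
  have hs2 : √2 < 1.5 := by nlinarith
  have hx : 0 < x := hy.trans_le hyx
  have h1 : ¬ y < (2 * √2 - 1) / 7 * x := by
    rw [not_lt]
    refine le_trans ?_ hxy
    gcongr
    linarith
  unfold Psi
  rw [if_neg h1, if_neg hxy.not_gt]
  split_ifs with h2
  · have hlt : y < x := h2.trans_le (mul_le_of_le_one_left hx.le (by linarith))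
    have hd : 0 < x - y := sub_pos.mpr hlt
    refine h.diffBound hy hyx (h.abs_partial_le_of_lt hy.le hlt) ?_ ?_
    · have e : 2 * (x + y ^ 2 / (x - y)) * x = 2 * (x ^ 2 + y ^ 2 * (x / (x - y))) := by ring
      rw [e]
      have : 1 ≤ x / (x - y) := by rw [one_le_div hd]; linarith
      have := mul_le_mul_of_nonneg_left this (sq_nonneg y)
      linarith
    · have e : √2 * y * (2 * (x + y ^ 2 / (x - y)))
          = 2 * √2 * y * (x ^ 2 - x * y + y ^ 2) / (x - y) := by
        field_simp
      rw [e, le_div_iff₀ hd]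
      have hq : 0 ≤ (3 + 2 * √2) * y ^ 2 - (2 + √2) * x * y + (1 + √2) * x ^ 2 := by
        nlinarith [sq_nonneg (2 * y - x), sq_nonneg (y - x), mul_pos hx hy, sq_nonneg y]
      have := mul_nonneg (sub_nonneg.mpr hxy) hq
      linear_combination this + (-x ^ 3 + x ^ 2 * y - 2 * x * y ^ 2) * hs
  · rw [not_lt] at h2
    refine h.diffBound hy hyx (h.abs_partial_le_of_le hy.le h2) ?_ ?_
    · nlinarith
    · nlinarith

end UpperBound

section Extremal

lemma boundedOnCone_three_point : BoundedOnCone 1 (5 + 4 * √2) (-(4 * (1 + √2))) := by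
  intro p q hq hqp
  have hs : √2 ^ 2 = (2 : ℝ) := sq_sqrt zero_le_two
  have hs1 : 1 ≤ √2 := one_lt_sqrt_two.le
  have e : 1 * p ^ 2 + (5 + 4 * √2) * q ^ 2 + -(4 * (1 + √2)) * p * q
      = 2 * (p - (1 + √2) * q) ^ 2 - (p ^ 2 + q ^ 2) := by
    linear_combination (-2 * q ^ 2) * hs
  have h : (p - (1 + √2) * q) ^ 2 ≤ p ^ 2 + q ^ 2 := by
    rcases le_total ((1 + √2) * q) p with h | h
    · have : 0 ≤ (1 + √2) * q := by positivity
      nlinarith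
    · have : ((1 + √2) * q - p) ^ 2 ≤ (√2 * q) ^ 2 := by
        gcongr
        linarith
      rw [mul_pow, hs] at this
      nlinarith
  rw [e, abs_le]
  constructor <;> nlinarith [sq_nonneg (p - (1 + √2) * q)]

lemma boundedOnCone_two_point {x y : ℝ} (hy : 0 ≤ y) (hyx : y < x) (h : y ≤ (2 - √2) * x) :
    BoundedOnCone (1 - y ^ 2 / (x - y) ^ 2) (1 - (2 * x - y) ^ 2 / (x - y) ^ 2)
      (2 * y * (2 * x - y) / (x - y) ^ 2) := by
  intro p q hq hqp
  have hs : √2 ^ 2 = (2 : ℝ) := sq_sqrt zero_le_two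
  have hd : 0 < x - y := sub_pos.mpr hyx
  have e : (1 - y ^ 2 / (x - y) ^ 2) * p ^ 2 + (1 - (2 * x - y) ^ 2 / (x - y) ^ 2) * q ^ 2
      + 2 * y * (2 * x - y) / (x - y) ^ 2 * p * q
      = (p ^ 2 + q ^ 2) - ((y * p - (2 * x - y) * q) / (x - y)) ^ 2 := by
    field_simp
    ring
  have hle : ((y * p - (2 * x - y) * q) / (x - y)) ^ 2 ≤ 2 * (p ^ 2 + q ^ 2) := by
    have hp : 0 ≤ p := hq.trans hqp
    rcases le_total 0 (y * p - (2 * x - y) * q) with h0 | h0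
    · have h1 : y ≤ √2 * (x - y) := by
        have := mul_le_mul_of_nonneg_left h (by positivity : 0 ≤ 1 + √2)
        linear_combination this - x * hs
      have h2 : (y * p - (2 * x - y) * q) / (x - y) ≤ √2 * p := by
        rw [div_le_iff₀ hd]
        nlinarith
      have h3 := pow_le_pow_left₀ (div_nonneg h0 hd.le) h2 2
      rw [mul_pow, hs] at h3
      nlinarith
    · have h2 : -((y * p - (2 * x - y) * q) / (x - y)) ≤ 2 * q := by
        rw [← neg_div, div_le_iff₀ hd]
        nlinarith
      have h3 := pow_le_pow_left₀ (neg_nonneg.mpr (div_nonpos_of_nonpos_of_nonneg h0 hd.le)) h2 2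
      rw [neg_sq] at h3
      nlinarith
  rw [e, abs_le]
  constructor
  · linarith
  · linarith [sq_nonneg ((y * p - (2 * x - y) * q) / (x - y))]

lemma exists_boundedOnCone_Psi_le {x y : ℝ} (hy : 0 < y) (hyx : y ≤ x)
    (hxy : (√2 - 1) * x ≤ y) :
    ∃ a b c : ℝ, BoundedOnCone a b c ∧ Psi x y ≤ |2 * a * x + c * y| := by
  have hs2 : √2 < 1.5 := by
    rw [sqrt_lt' (by norm_num)]
    norm_num
  have hs1 : 1 < √2 := one_lt_sqrt_two
  have hx : 0 < x := hy.trans_le hyx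
  have h1 : ¬ y < (2 * √2 - 1) / 7 * x := by
    rw [not_lt]
    refine le_trans ?_ hxy
    gcongr
    have : 1.4 < √2 := lt_sqrt_of_sq_lt (by norm_num)
    linarith
  unfold Psi
  rw [if_neg h1, if_neg hxy.not_gt]
  split_ifs with h2
  · have hlt : y < x := h2.trans_le (mul_le_of_le_one_left hx.le (by linarith))
    have hd : 0 < x - y := sub_pos.mpr hlt
    refine ⟨_, _, _, boundedOnCone_two_point hy.le hlt h2.le, le_abs.mpr (Or.inl (le_of_eq ?_))⟩
    field_simp
    ring
  · refine ⟨_, _, _, boundedOnCone_three_point, le_abs.mpr (Or.inr (le_of_eq ?_))⟩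
    ring

end Extremal

lemma isGreatest_Psi_of_le {x y : ℝ} (hy : 0 < y) (hyx : y ≤ x) (hxy : (√2 - 1) * x ≤ y) :
    IsGreatest {r : ℝ | ∃ a b c : ℝ, secNorm a b c ≤ 1 ∧ r = diffNorm a b c x y} (Psi x y) := by
  constructor
  · obtain ⟨a, b, c, h, hle⟩ := exists_boundedOnCone_Psi_le hy hyx hxy
    have hb := h.diffBound_Psi hy hyx hxy
    refine ⟨a, b, c, secNorm_le_one_iff_s7.mpr h, le_antisymm ?_ hb.diffNorm_le⟩
    have := hb.le_diffNorm (u := 1) (v := 0) (by simp [sector])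
    rw [mul_one, mul_zero, add_zero] at this
    exact hle.trans this
  · rintro _ ⟨a, b, c, h, rfl⟩
    exact ((secNorm_le_one_iff_s7.mp h).diffBound_Psi hy hyx hxy).diffNorm_le

theorem stmt_7 (x y : ℝ) (hxy : (x, y) ∈ sector) :
    Psi x y = sSup {r : ℝ | ∃ a b c : ℝ, secNorm a b c ≤ 1 ∧ r = diffNorm a b c x y} := by
  obtain ⟨hy, hyx, -⟩ := id hxy
  simp only at hy hyx
  have hs1 : 1 < √2 := one_lt_sqrt_two
  rcases (hy.trans hyx).eq_or_lt with rfl | hx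
  · obtain rfl : y = 0 := le_antisymm hyx hy
    have h0 : ∀ a b c : ℝ, diffNorm a b c 0 0 = 0 := by
      intro a b c
      have : (fun q : ℝ × ℝ => |(2 * a * 0 + c * 0) * q.1 + (2 * b * 0 + c * 0) * q.2|)
          = fun _ => (0 : ℝ) := by
        ext q
        simp
      rw [diffNorm, this, Set.Nonempty.image_const ⟨_, zero_mem_sector⟩, csSup_singleton]
    have hset : {r : ℝ | ∃ a b c : ℝ, secNorm a b c ≤ 1 ∧ r = diffNorm a b c 0 0} = {0} := by
      ext r
      simp only [h0, mem_ofPred_eq, mem_singleton_iff]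
      refine ⟨fun ⟨_, _, _, _, h⟩ => h, fun h =>
        ⟨_, _, _, secNorm_le_one_iff_s7.mpr boundedOnCone_three_point, h⟩⟩
    rw [hset, csSup_singleton]
    simp [Psi]
  rcases le_or_gt ((√2 - 1) * x) y with h | h
  · exact (isGreatest_Psi_of_le ((mul_pos (by linarith) hx).trans_le h) hyx h).csSup_eq.symm
  · have hs : √2 ^ 2 = (2 : ℝ) := sq_sqrt zero_le_two
    have hlt : y < x := h.trans_le (mul_le_of_le_one_left hx.le (by nlinarith))
    rw [← setOf_diffNorm_reflection, ← Psi_reflection hy h]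
    refine (isGreatest_Psi_of_le (div_pos (by linarith) (by positivity))
      (by gcongr; linarith) ?_).csSup_eq.symm
    rw [mul_div_assoc']
    gcongr
    nlinarith
end
end

section
/- For every (a,b,c) ∈ ℝ³ and every (x,y) ∈ D(π/4), ‖DP_{a,b,c}(x,y)‖ ≤ (4+√2)·‖(a,b,c)‖. Moreover this global bound is attained: for the triple (1, 5+4√2, −4−4√2) one has ‖(1, 5+4√2, −4−4√2)‖ = 1 and sup{ ‖DP_{1,5+4√2,−4−4√2}(x,y)‖ : (x,y) ∈ D(π/4) } = 4+√2. -/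
open Real Set

noncomputable section

lemma fst_snd_le_one {p : ℝ × ℝ} (hp : p ∈ sector) :
    0 ≤ p.1 ∧ p.1 ≤ 1 ∧ 0 ≤ p.2 ∧ p.2 ≤ 1 := by
  obtain ⟨h0, h1, h2⟩ := hp
  exact ⟨h0.trans h1, by nlinarith, h0, by nlinarith⟩

lemma abs_eval_le_secNorm (a b c : ℝ) {p : ℝ × ℝ} (hp : p ∈ sector) :
    |a * p.1 ^ 2 + b * p.2 ^ 2 + c * p.1 * p.2| ≤ secNorm a b c := by
  refine le_csSup ⟨|a| + |b| + |c|, ?_⟩ ⟨p, hp, rfl⟩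
  rintro _ ⟨q, hq, rfl⟩
  obtain ⟨h1, h2, h3, h4⟩ := fst_snd_le_one hq
  refine (abs_add_three _ _ _).trans ?_
  rw [mul_assoc c, abs_mul, abs_mul, abs_mul c, abs_of_nonneg (by positivity : 0 ≤ q.1 ^ 2),
    abs_of_nonneg (by positivity : 0 ≤ q.2 ^ 2), abs_of_nonneg (by positivity : 0 ≤ q.1 * q.2)]
  gcongr
  · exact mul_le_of_le_one_right (abs_nonneg _) (pow_le_one₀ h1 h2)
  · exact mul_le_of_le_one_right (abs_nonneg _) (pow_le_one₀ h3 h4)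
  · exact mul_le_of_le_one_right (abs_nonneg _) (mul_le_one₀ h2 h3 h4)

lemma abs_differential_le_diffNorm (a b c x y : ℝ) {q : ℝ × ℝ} (hq : q ∈ sector) :
    |(2 * a * x + c * y) * q.1 + (2 * b * y + c * x) * q.2| ≤ diffNorm a b c x y := by
  refine le_csSup ⟨|2 * a * x + c * y| + |2 * b * y + c * x|, ?_⟩ ⟨q, hq, rfl⟩
  rintro _ ⟨q, hq, rfl⟩
  obtain ⟨h1, h2, h3, h4⟩ := fst_snd_le_one hq
  refine (abs_add_le _ _).trans ?_
  rw [abs_mul, abs_mul, abs_of_nonneg h1, abs_of_nonneg h3]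
  gcongr
  · exact mul_le_of_le_one_right (abs_nonneg _) h2
  · exact mul_le_of_le_one_right (abs_nonneg _) h4

lemma sqrt_two_bounds : √2 ^ 2 = 2 ∧ 1.4 < √2 ∧ √2 < 1.5 :=
  ⟨Real.sq_sqrt (by norm_num), Real.lt_sqrt_of_sq_lt (by norm_num),
    (Real.sqrt_lt' (by norm_num)).2 (by norm_num)⟩

lemma diagonal_mem_sector : ((√2 / 2, √2 / 2) : ℝ × ℝ) ∈ sector := by
  obtain ⟨h, -, -⟩ := sqrt_two_bounds
  refine ⟨by positivity, le_rfl, ?_⟩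
  simp only
  nlinarith

/-- The value at the point of the unit circle with angle `π / 8`. -/
lemma abs_eval_pi_div_eight_le_secNorm (a b c : ℝ) :
    |(a + b) / 2 + (a - b + c) * √2 / 4| ≤ secNorm a b c := by
  obtain ⟨h, h1, h2⟩ := sqrt_two_bounds
  have hs1 : √(2 + √2) ^ 2 = 2 + √2 := Real.sq_sqrt (by linarith)
  have hs2 : √(2 - √2) ^ 2 = 2 - √2 := Real.sq_sqrt (by linarith)
  have hp : √(2 + √2) * √(2 - √2) = √2 := by
    rw [← Real.sqrt_mul (by linarith)]
    congr 1
    linarith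
  have hmem : ((√(2 + √2) / 2, √(2 - √2) / 2) : ℝ × ℝ) ∈ sector := by
    refine ⟨by positivity, ?_, ?_⟩
    · have : √(2 - √2) ≤ √(2 + √2) := Real.sqrt_le_sqrt (by linarith)
      simp only
      linarith
    · simp only [div_pow, hs1, hs2]
      linarith
  convert abs_eval_le_secNorm a b c hmem using 2
  simp only [div_pow, hs1, hs2]
  linear_combination (-c / 4) * hp

/-- The `ℓ¹` norm of the coefficients of the polar form in terms of the values of the polynomial at
the angles `0`, `π / 8` and `π / 4`. -/
lemma interpolation_coeff_bound {x y u v : ℝ} (hp : (x, y) ∈ sector) (hq : (u, v) ∈ sector) :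
    (√2 + 1) * (y * u + x * v - 2 * (y * v)) +
      |x * u - y * v - (1 + √2 / 2) * (y * u + x * v - 2 * (y * v))| +
      |y * u + x * v - (1 + √2 / 2) * (y * u + x * v - 2 * (y * v))| ≤ 2 + √2 / 2 := by
  obtain ⟨hy, hyx, hxy⟩ := hp
  obtain ⟨hv, hvu, huv⟩ := hq
  simp only at hy hyx hxy hv hvu huv
  obtain ⟨h, h1, h2⟩ := sqrt_two_bounds
  set s := √2
  obtain ⟨w, hw0, hw1, hw⟩ : ∃ w : ℝ, 0 ≤ w ∧ w ≤ 1 ∧ w ^ 2 = (x ^ 2 + y ^ 2) * (u ^ 2 + v ^ 2) :=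
    ⟨√((x ^ 2 + y ^ 2) * (u ^ 2 + v ^ 2)), Real.sqrt_nonneg _,
      Real.sqrt_le_one.2 (mul_le_one₀ hxy (by positivity) huv), Real.sq_sqrt (by positivity)⟩
  have hx : 0 ≤ x := hy.trans hyx
  have hu : 0 ≤ u := hv.trans hvu
  have hxu := mul_nonneg hx hu
  have hyv := mul_nonneg hy hv
  have hxv := mul_nonneg hx hv
  have hyu := mul_nonneg hy hu
  have h_xv : x * v ≤ x * u := mul_le_mul_of_nonneg_left hvu hx
  have h_yu : y * u ≤ x * u := mul_le_mul_of_nonneg_right hyx hu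
  have hM : x * u - y * v ≤ w :=
    abs_le_of_sq_le_sq' (by nlinarith [sq_nonneg (y * u + x * v)]) hw0 |>.2
  have hN : y * u + x * v ≤ w :=
    abs_le_of_sq_le_sq' (by nlinarith [sq_nonneg (x * u - y * v)]) hw0 |>.2
  have hC : x * u + y * v ≤ w :=
    abs_le_of_sq_le_sq' (by nlinarith [sq_nonneg (x * v - y * u)]) hw0 |>.2
  have hMN : (x * u - y * v) + (y * u + x * v) ≤ s * w :=
    abs_le_of_sq_le_sq' (by rw [mul_pow, h]; nlinarith [sq_nonneg (x * u - y * v - (y * u + x * v))])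
      (by positivity) |>.2
  have hw' : w ≤ s * (x * u + y * v) :=
    abs_le_of_sq_le_sq' (by
      rw [mul_pow, h]
      nlinarith [mul_nonneg (by linarith : 0 ≤ x * u + y * v - (x * v - y * u))
        (by linarith : 0 ≤ x * u + y * v + (x * v - y * u))]) (by positivity) |>.2
  generalize x * u = X at *
  generalize y * v = Y at *
  generalize y * u + x * v = N at *
  have hsw : s * w ≤ s := mul_le_of_le_one_right (by linarith) hw1
  have hsM : s * (X - Y) ≤ s * w := mul_le_mul_of_nonneg_left hM (by linarith)
  have hsMN : s * (X - Y + N) ≤ 2 * w := by nlinarith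
  rcases abs_cases (X - Y - (1 + s / 2) * (N - 2 * Y)) with ⟨e1, -⟩ | ⟨e1, -⟩ <;>
  rcases abs_cases (N - (1 + s / 2) * (N - 2 * Y)) with ⟨e2, -⟩ | ⟨e2, -⟩ <;>
  rw [e1, e2]
  · linarith
  · nlinarith
  · nlinarith
  · nlinarith

lemma diffNorm_le (a b c x y : ℝ) (hp : (x, y) ∈ sector) :
    diffNorm a b c x y ≤ (4 + √2) * secNorm a b c := by
  refine csSup_le (Set.Nonempty.image _ ⟨_, zero_mem_sector⟩) ?_
  rintro _ ⟨⟨u, v⟩, hq, rfl⟩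
  have h0 : |a| ≤ secNorm a b c := by
    simpa using abs_eval_le_secNorm a b c (p := (1, 0)) (by simp [sector])
  have h1 := abs_eval_pi_div_eight_le_secNorm a b c
  obtain ⟨h, -, -⟩ := sqrt_two_bounds
  have h2 : |(a + b + c) / 2| ≤ secNorm a b c := by
    convert abs_eval_le_secNorm a b c diagonal_mem_sector using 2
    simp only
    linear_combination (-(a + b + c) / 4) * h
  have hK : 0 ≤ secNorm a b c := (abs_nonneg a).trans h0
  have key := interpolation_coeff_bound hp hq
  obtain ⟨hy, hyx, -⟩ := hp
  obtain ⟨hv, hvu, -⟩ := hq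
  simp only at hy hyx hv hvu ⊢
  have hE : 0 ≤ y * u + x * v - 2 * (y * v) := by nlinarith
  have hid : (2 * a * x + c * y) * u + (2 * b * y + c * x) * v =
      2 * (((a + b) / 2 + (a - b + c) * √2 / 4) *
          ((√2 + 1) * (y * u + x * v - 2 * (y * v))) +
        a * (x * u - y * v - (1 + √2 / 2) * (y * u + x * v - 2 * (y * v))) +
        (a + b + c) / 2 *
          (y * u + x * v - (1 + √2 / 2) * (y * u + x * v - 2 * (y * v)))) := by
    linear_combination (-(a - b + c) / 2 * (y * u + x * v - 2 * (y * v))) * h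
  have hE' : 0 ≤ (√2 + 1) * (y * u + x * v - 2 * (y * v)) := by positivity
  rw [hid, abs_mul, abs_two]
  refine (mul_le_mul_of_nonneg_left (abs_add_three _ _ _) zero_le_two).trans ?_
  rw [abs_mul (_ / 2 + _ / 4), abs_mul a, abs_mul (_ / 2), abs_of_nonneg hE']
  have t0 := mul_le_mul_of_nonneg_right h0
    (abs_nonneg (x * u - y * v - (1 + √2 / 2) * (y * u + x * v - 2 * (y * v))))
  have t1 := mul_le_mul_of_nonneg_right h1 hE'
  have t2 := mul_le_mul_of_nonneg_right h2
    (abs_nonneg (y * u + x * v - (1 + √2 / 2) * (y * u + x * v - 2 * (y * v))))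
  have t3 := mul_le_mul_of_nonneg_left key hK
  linarith

lemma secNorm_extremal : secNorm 1 (5 + 4 * √2) (-4 - 4 * √2) = 1 := by
  apply le_antisymm
  · refine csSup_le (Set.Nonempty.image _ ⟨_, zero_mem_sector⟩) ?_
    rintro _ ⟨⟨x, y⟩, ⟨hy, hyx, hxy⟩, rfl⟩
    simp only at hy hyx hxy ⊢
    obtain ⟨h, h1, -⟩ := sqrt_two_bounds
    rw [abs_le]
    constructor
    · have hsq : 0 ≤ 2 * (x - (1 + √2) * y) ^ 2 := by positivity
      have hexp : 2 * (x - (1 + √2) * y) ^ 2 =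
          2 * x ^ 2 + (6 + 4 * √2) * y ^ 2 - (4 + 4 * √2) * x * y := by
        linear_combination (2 * y ^ 2) * h
      linarith
    · have : 0 ≤ (4 + 4 * √2) * (y * (x - y)) :=
        mul_nonneg (by positivity) (mul_nonneg hy (by linarith))
      linarith
  · simpa using abs_eval_le_secNorm 1 (5 + 4 * √2) (-4 - 4 * √2) (p := (1, 0)) (by simp [sector])

theorem stmt_8 :
    (∀ a b c x y : ℝ, (x, y) ∈ sector →
      diffNorm a b c x y ≤ (4 + Real.sqrt 2) * secNorm a b c) ∧
    secNorm 1 (5 + 4 * Real.sqrt 2) (-4 - 4 * Real.sqrt 2) = 1 ∧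
    sSup {r : ℝ | ∃ p ∈ sector,
        r = diffNorm 1 (5 + 4 * Real.sqrt 2) (-4 - 4 * Real.sqrt 2) p.1 p.2} =
      4 + Real.sqrt 2 := by
  have hle : ∀ p ∈ sector, diffNorm 1 (5 + 4 * √2) (-4 - 4 * √2) p.1 p.2 ≤ 4 + √2 := by
    intro p hp
    simpa [secNorm_extremal] using diffNorm_le 1 (5 + 4 * √2) (-4 - 4 * √2) p.1 p.2 hp
  refine ⟨diffNorm_le, secNorm_extremal, IsGreatest.csSup_eq ⟨?_, ?_⟩⟩
  · have hmem : ((1, 0) : ℝ × ℝ) ∈ sector := by simp [sector]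
    refine ⟨(1, 0), hmem, le_antisymm ?_ (hle _ hmem)⟩
    obtain ⟨h, -, -⟩ := sqrt_two_bounds
    refine le_trans (le_of_eq ?_)
      (abs_differential_le_diffNorm 1 (5 + 4 * √2) (-4 - 4 * √2) 1 0 diagonal_mem_sector)
    rw [← abs_of_nonneg (by positivity : 0 ≤ 4 + √2), ← abs_neg]
    congr 1
    simp only
    linear_combination 2 * h
  · rintro _ ⟨p, hp, rfl⟩
    exact hle p hp
end
end

section
/- For every t ∈ [−1,1], ‖(|t|, 4+t+4·√(1+t), 2+2t+4·√(1+t))‖ = (1/2)·(|t| + 6 + 3t + 8·√(1+t)). Consequently sup{ ‖(|t|, 4+t+4·√(1+t), 2+2t+4·√(1+t))‖ : t ∈ [−1,1] } = 5+4√2, and the supremum is attained at t = 1. -/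
open Real Set

noncomputable section

/-- For coefficients `0 ≤ a ≤ b` and `0 ≤ c`, the norm is attained at `(√2/2, √2/2)`. -/
theorem secNorm_eq_of_le {a b c : ℝ} (ha : 0 ≤ a) (hab : a ≤ b) (hc : 0 ≤ c) :
    secNorm a b c = (a + b + c) / 2 := by
  have h2 : (√2 / 2) ^ 2 = (1 / 2 : ℝ) := by
    rw [div_pow, Real.sq_sqrt (by norm_num)]; norm_num
  refine IsGreatest.csSup_eq ⟨⟨(√2 / 2, √2 / 2), ⟨by positivity, le_rfl, ?_⟩, ?_⟩, ?_⟩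
  · simp only [h2]; norm_num
  · have h : a * (√2 / 2) ^ 2 + b * (√2 / 2) ^ 2 + c * (√2 / 2) * (√2 / 2)
        = (a + b + c) / 2 := by linear_combination (a + b + c) * h2
    simp only [h]
    exact abs_of_nonneg (by linarith)
  · rintro _ ⟨⟨x, y⟩, ⟨hy, hyx, hxy⟩, rfl⟩
    simp only at hy hyx hxy ⊢
    have hx : 0 ≤ x := hy.trans hyx
    have hb : 0 ≤ b := ha.trans hab
    rw [abs_of_nonneg (by positivity)]
    have h1 : 0 ≤ (b - a) * (x ^ 2 - y ^ 2) :=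
      mul_nonneg (sub_nonneg.2 hab) (sub_nonneg.2 (pow_le_pow_left₀ hy hyx 2))
    have h3 : 0 ≤ c * (x - y) ^ 2 := by positivity
    have h4 : 0 ≤ (a + b + c) * (1 - (x ^ 2 + y ^ 2)) :=
      mul_nonneg (by positivity) (sub_nonneg.2 hxy)
    linarith

theorem stmt_11 :
    (∀ t ∈ Set.Icc (-1 : ℝ) 1,
      secNorm |t| (4 + t + 4 * Real.sqrt (1 + t)) (2 + 2 * t + 4 * Real.sqrt (1 + t)) =
        (1 / 2) * (|t| + 6 + 3 * t + 8 * Real.sqrt (1 + t))) ∧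
    sSup {r : ℝ | ∃ t ∈ Set.Icc (-1 : ℝ) 1,
        r = secNorm |t| (4 + t + 4 * Real.sqrt (1 + t)) (2 + 2 * t + 4 * Real.sqrt (1 + t))} =
      5 + 4 * Real.sqrt 2 ∧
    secNorm |(1 : ℝ)| (4 + 1 + 4 * Real.sqrt (1 + 1)) (2 + 2 * 1 + 4 * Real.sqrt (1 + 1)) =
      5 + 4 * Real.sqrt 2 := by
  have key : ∀ t ∈ Set.Icc (-1 : ℝ) 1,
      secNorm |t| (4 + t + 4 * Real.sqrt (1 + t)) (2 + 2 * t + 4 * Real.sqrt (1 + t)) =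
        (1 / 2) * (|t| + 6 + 3 * t + 8 * Real.sqrt (1 + t)) := by
    rintro t ⟨ht1, ht2⟩
    have hs := Real.sqrt_nonneg (1 + t)
    have habs : |t| ≤ 1 := abs_le.2 ⟨ht1, ht2⟩
    rw [secNorm_eq_of_le (abs_nonneg t) (by linarith) (by linarith)]
    ring
  have hone : secNorm |(1 : ℝ)| (4 + 1 + 4 * Real.sqrt (1 + 1))
      (2 + 2 * 1 + 4 * Real.sqrt (1 + 1)) = 5 + 4 * Real.sqrt 2 := by
    rw [key 1 (by norm_num), abs_one, one_add_one_eq_two]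
    ring
  refine ⟨key, IsGreatest.csSup_eq ⟨⟨1, by norm_num, hone.symm⟩, ?_⟩, hone⟩
  rintro _ ⟨t, ht, rfl⟩
  rw [key t ht]
  have habs : |t| ≤ 1 := abs_le.2 ht
  have hs : Real.sqrt (1 + t) ≤ Real.sqrt 2 := Real.sqrt_le_sqrt (by linarith [ht.2])
  linarith [ht.2]
end
end

section
/- For every s ∈ [1, 5+4√2], ‖(1, s, 2·√(2·(1+s)))‖ = (1/2)·(1 + s + 2·√(2·(1+s))). Consequently sup{ ‖(1, s, 2·√(2·(1+s)))‖ : s ∈ [1, 5+4√2] } = 5+4√2, and the supremum is attained at s = 5+4√2. -/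
open Real Set

noncomputable section

/-- If `1 ≤ s` and `0 ≤ c`, the polynomial `x² + s y² + c x y` attains its norm over the sector
at the corner `(1/√2, 1/√2)`. -/
theorem secNorm_one_of_one_le {s c : ℝ} (hs : 1 ≤ s) (hc : 0 ≤ c) :
    secNorm 1 s c = (1 / 2) * (1 + s + c) := by
  refine IsGreatest.csSup_eq ⟨⟨(√(1 / 2), √(1 / 2)), ?_, ?_⟩, ?_⟩
  · have h : √(1 / 2 : ℝ) ^ 2 = 1 / 2 := Real.sq_sqrt (by norm_num)
    refine ⟨Real.sqrt_nonneg _, le_rfl, ?_⟩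
    linarith
  · have h : √(1 / 2 : ℝ) ^ 2 = 1 / 2 := Real.sq_sqrt (by norm_num)
    have e : 1 * √(1 / 2 : ℝ) ^ 2 + s * √(1 / 2 : ℝ) ^ 2 + c * √(1 / 2 : ℝ) * √(1 / 2 : ℝ)
        = (1 / 2) * (1 + s + c) := by linear_combination (1 + s + c) * h
    change |1 * √(1 / 2 : ℝ) ^ 2 + s * √(1 / 2 : ℝ) ^ 2 + c * √(1 / 2 : ℝ) * √(1 / 2 : ℝ)| = _
    rw [e, abs_of_nonneg (by linarith)]
  · rintro _ ⟨⟨x, y⟩, ⟨hy, hyx, hxy⟩, rfl⟩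
    dsimp only at hy hyx hxy ⊢
    have hx : 0 ≤ x := hy.trans hyx
    rw [abs_of_nonneg (by positivity)]
    have hyy : y ^ 2 ≤ 1 / 2 := by nlinarith
    have hprod : x * y ≤ 1 / 2 := by nlinarith [sq_nonneg (x - y)]
    nlinarith [mul_le_mul_of_nonneg_left hyy (sub_nonneg.2 hs),
      mul_le_mul_of_nonneg_left hprod hc]

theorem sqrt_two_mul_one_add_five_add_four_sqrt_two :
    √(2 * (1 + (5 + 4 * √2))) = 2 + 2 * √2 := by
  rw [Real.sqrt_eq_iff_mul_self_eq (by positivity) (by positivity)]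
  linear_combination -4 * Real.sq_sqrt (show (0 : ℝ) ≤ 2 by norm_num)

theorem stmt_12 :
    (∀ s ∈ Set.Icc (1 : ℝ) (5 + 4 * Real.sqrt 2),
      secNorm 1 s (2 * Real.sqrt (2 * (1 + s))) =
        (1 / 2) * (1 + s + 2 * Real.sqrt (2 * (1 + s)))) ∧
    sSup {r : ℝ | ∃ s ∈ Set.Icc (1 : ℝ) (5 + 4 * Real.sqrt 2),
        r = secNorm 1 s (2 * Real.sqrt (2 * (1 + s)))} = 5 + 4 * Real.sqrt 2 ∧
    secNorm 1 (5 + 4 * Real.sqrt 2) (2 * Real.sqrt (2 * (1 + (5 + 4 * Real.sqrt 2)))) =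
      5 + 4 * Real.sqrt 2 := by
  have formula : ∀ s ∈ Set.Icc (1 : ℝ) (5 + 4 * √2),
      secNorm 1 s (2 * √(2 * (1 + s))) = (1 / 2) * (1 + s + 2 * √(2 * (1 + s))) :=
    fun s hs => secNorm_one_of_one_le hs.1 (by positivity)
  have endpoint_mem : 5 + 4 * √2 ∈ Set.Icc (1 : ℝ) (5 + 4 * √2) :=
    ⟨by linarith [Real.sqrt_nonneg 2], le_rfl⟩
  have endpoint : secNorm 1 (5 + 4 * √2) (2 * √(2 * (1 + (5 + 4 * √2)))) = 5 + 4 * √2 := by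
    rw [formula _ endpoint_mem, sqrt_two_mul_one_add_five_add_four_sqrt_two]
    ring
  refine ⟨formula, IsGreatest.csSup_eq ⟨⟨_, endpoint_mem, endpoint.symm⟩, ?_⟩, endpoint⟩
  rintro _ ⟨s, hs, rfl⟩
  have hsqrt : √(2 * (1 + s)) ≤ √(2 * (1 + (5 + 4 * √2))) :=
    Real.sqrt_le_sqrt (by linarith [hs.2])
  rw [sqrt_two_mul_one_add_five_add_four_sqrt_two] at hsqrt
  rw [formula s hs]
  linarith [hs.2]
end
end

section
/- For every t ∈ [−1,1], ‖P_t‖ = 1; that is, sup{ |t·x² + (4+t+4·√(1+t))·y² − (2+2t+4·√(1+t))·x·y| : (x,y) ∈ D(π/4) } = 1. -/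
open Real Set

noncomputable section

theorem sq_linear_le_two_mul {s x y : ℝ} (hs : 0 ≤ s) (hs2 : s ^ 2 ≤ 2) (hy : 0 ≤ y)
    (hyx : y ≤ x) : (s * x - (s + 2) * y) ^ 2 ≤ 2 * (x ^ 2 + y ^ 2) := by
  rcases le_total 0 (s * x - (s + 2) * y) with hu | hu
  · have h1 : s * x - (s + 2) * y ≤ s * x := by
      have : 0 ≤ (s + 2) * y := by positivity
      linarith
    have h2 := pow_le_pow_left₀ hu h1 2
    nlinarith [mul_le_mul_of_nonneg_right hs2 (sq_nonneg x), sq_nonneg y]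
  · have h1 : -(s * x - (s + 2) * y) ≤ 2 * y := by
      have : 0 ≤ s * (x - y) := mul_nonneg hs (sub_nonneg.2 hyx)
      linarith
    have h2 := pow_le_pow_left₀ (neg_nonneg.2 hu) h1 2
    have h3 := pow_le_pow_left₀ hy hyx 2
    linarith [neg_sq (s * x - (s + 2) * y), mul_pow 2 y 2]

theorem stmt_13 (t : ℝ) (ht : t ∈ Set.Icc (-1 : ℝ) 1) :
    secNorm t (4 + t + 4 * Real.sqrt (1 + t)) (-2 - 2 * t - 4 * Real.sqrt (1 + t)) = 1 := by
  obtain ⟨ht1, ht2⟩ := ht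
  have hs : 0 ≤ √(1 + t) := Real.sqrt_nonneg _
  have hss : √(1 + t) ^ 2 = 1 + t := Real.sq_sqrt (by linarith)
  generalize √(1 + t) = s at hs hss ⊢
  obtain rfl : t = s ^ 2 - 1 := by linarith
  have key (x y : ℝ) : (s ^ 2 - 1) * x ^ 2 + (4 + (s ^ 2 - 1) + 4 * s) * y ^ 2
      + (-2 - 2 * (s ^ 2 - 1) - 4 * s) * x * y
      = (s * x - (s + 2) * y) ^ 2 - (x ^ 2 + y ^ 2) := by ring
  refine IsGreatest.csSup_eq ⟨?_, ?_⟩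
  · have hpos : 0 < (s + 2) ^ 2 + s ^ 2 := by positivity
    set r := √((s + 2) ^ 2 + s ^ 2)
    have hr : 0 < r := Real.sqrt_pos.2 hpos
    have hrr : r ^ 2 = (s + 2) ^ 2 + s ^ 2 := Real.sq_sqrt hpos.le
    have hunit : ((s + 2) / r) ^ 2 + (s / r) ^ 2 = 1 := by
      rw [div_pow, div_pow, ← add_div, ← hrr, div_self (by positivity)]
    have hzero : s * ((s + 2) / r) - (s + 2) * (s / r) = 0 := by ring
    refine ⟨((s + 2) / r, s / r), ⟨by positivity, ?_, hunit.le⟩, ?_⟩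
    · exact div_le_div_of_nonneg_right (by linarith) hr.le
    · simp only [key, hunit, hzero]
      norm_num
  · rintro _ ⟨⟨x, y⟩, ⟨hy, hyx, hxy⟩, rfl⟩
    simp only [key] at hy hyx hxy ⊢
    have h := sq_linear_le_two_mul hs (by linarith) hy hyx
    rw [abs_le]
    constructor <;> linarith [sq_nonneg (s * x - (s + 2) * y)]
end
end

section
/- For every s ∈ [1, 5+4√2], ‖Q_s‖ = 1; that is, sup{ |x² + s·y² − 2·√(2·(1+s))·x·y| : (x,y) ∈ D(π/4) } = 1. -/
open Real Set

noncomputable section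

theorem stmt_14 (s : ℝ) (hs : s ∈ Set.Icc (1 : ℝ) (5 + 4 * Real.sqrt 2)) :
    secNorm 1 s (-2 * Real.sqrt (2 * (1 + s))) = 1 := by
  obtain ⟨hs1, hs2⟩ := hs
  have h2 : √(2 : ℝ) ^ 2 = 2 := Real.sq_sqrt (by norm_num)
  set t := √(2 * (1 + s)) with ht
  have ht0 : 0 ≤ t := Real.sqrt_nonneg _
  have htsq : t ^ 2 = 2 * (1 + s) := Real.sq_sqrt (by linarith)
  have htle : t ≤ 2 + 2 * √2 :=
    abs_le_of_sq_le_sq' (by nlinarith) (by positivity) |>.2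
  have hst : s - 1 ≤ 2 * t := by
    have h1 : 1 ≤ √(2 : ℝ) := Real.one_le_sqrt.2 (by norm_num)
    nlinarith [mul_nonneg (sub_nonneg.2 htle) (by linarith : 0 ≤ t + 2 * √2 - 2)]
  have hmax : IsGreatest
      ((fun p : ℝ × ℝ => |1 * p.1 ^ 2 + s * p.2 ^ 2 + -2 * t * p.1 * p.2|) '' sector) 1 := by
    refine ⟨⟨(1, 0), by norm_num [sector], by norm_num⟩, ?_⟩
    rintro _ ⟨⟨x, y⟩, ⟨hy, hyx, hxy⟩, rfl⟩
    dsimp only at hy hyx hxy ⊢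
    rw [abs_le]
    constructor
    · have hsq : 2 * (x - t * y / 2) ^ 2 = 2 * x ^ 2 - 2 * t * x * y + (1 + s) * y ^ 2 := by
        linear_combination (y ^ 2 / 2) * htsq
      linarith [sq_nonneg (x - t * y / 2)]
    · have hupper : (s - 1) * y * y ≤ 2 * t * x * y := by
        gcongr
      linarith
  exact hmax.csSup_eq
end
end
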